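/- arXiv:2104.12057 — 4 statements merged into one kernel-verified Lean document; each statement's English description precedes it below -/
import Mathlib

section
/- Let G be a finite simple graph whose maximum matching has size s_max, and let M be a matching of G whose size satisfies |M| ≤ s_max − k for some integer k ≥ 1. Then there exists an augmenting path with respect to M of length strictly less than ⌊2·s_max/k⌋. -/
namespace MM

open SimpleGraph

variable {V : Type*}

/-- `M` is a matching of `G`: a set of edges of `G` no two of which share an endpoint. -/
def IsMatching (G : SimpleGraph V) (M : Set (Sym2 V)) : Prop :=
  M ⊆ G.edgeSet ∧ ∀ e ∈ M, ∀ e' ∈ M, ∀ v : V, v ∈ e → v ∈ e' → e = e'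

/-- A node is matched if it is an endpoint of an edge of `M`. -/
def Matched (M : Set (Sym2 V)) (v : V) : Prop :=
  ∃ e ∈ M, v ∈ e

/-- A list of edges alternates w.r.t. `M`: for consecutive edges, exactly one belongs to `M`. -/
def AltList (M : Set (Sym2 V)) (l : List (Sym2 V)) : Prop :=
  ∀ (i : ℕ) (h : i + 1 < l.length),
    (l.get ⟨i, Nat.lt_of_succ_lt h⟩ ∈ M ↔ l.get ⟨i + 1, h⟩ ∉ M)

/-- An alternating path: a simple path whose edges alternate w.r.t. `M`. -/
def IsAltPath {G : SimpleGraph V} (M : Set (Sym2 V)) {u v : V} (p : G.Walk u v) : Prop :=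
  p.IsPath ∧ AltList M p.edges

/-- An augmenting path: an alternating path whose two (distinct) endpoints are unmatched. -/
def IsAugPath (G : SimpleGraph V) (M : Set (Sym2 V)) {u v : V} (p : G.Walk u v) : Prop :=
  IsAltPath M p ∧ u ≠ v ∧ ¬ Matched M u ∧ ¬ Matched M v

/-- `v` is `θ`-reachable from `f` in `H`: there is a `θ`-alternating path from `f` to `v`. -/
def ThetaReach (H : SimpleGraph V) (M : Set (Sym2 V)) (θ : ℕ) (f v : V) : Prop :=
  ∃ p : H.Walk f v, IsAltPath M p ∧ p.length % 2 = θ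

/-- `r^θ_H(f,v)`: the minimum length of a `θ`-alternating path from `f` to `v` in `H`
(`⊤` if none exists). -/
noncomputable def rAlt (H : SimpleGraph V) (M : Set (Sym2 V)) (θ : ℕ) (f v : V) : ℕ∞ :=
  sInf {n : ℕ∞ | ∃ p : H.Walk f v, IsAltPath M p ∧ p.length % 2 = θ ∧ (p.length : ℕ∞) = n}

/-- `r_H(f,v) = min(r^0_H(f,v), r^1_H(f,v))`. -/
noncomputable def rMin (H : SimpleGraph V) (M : Set (Sym2 V)) (f v : V) : ℕ∞ :=
  min (rAlt H M 0 f v) (rAlt H M 1 f v)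

open Classical in
/-- `γ(v)`: the parity achieving the minimum of `r^θ_G(f,v)`. -/
noncomputable def gam (G : SimpleGraph V) (M : Set (Sym2 V)) (f v : V) : ℕ :=
  if rAlt G M 0 f v ≤ rAlt G M 1 f v then 0 else 1

/-- An alternating base tree for `(G, M, f)`: a spanning tree `T` of `G` rooted at `f`
(with parent function `par`) such that the edge from each `v ≠ f` to its parent is the
last edge of a shortest alternating path from `f` to `v` in `G`. -/
structure AltBaseTree (G : SimpleGraph V) (M : Set (Sym2 V)) (f : V)
    (T : SimpleGraph V) (par : V → V) : Prop where
  le : T ≤ G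
  tree : T.IsTree
  adj : ∀ v, v ≠ f → T.Adj v (par v)
  parent_dist : ∀ v, v ≠ f → T.dist f v = T.dist f (par v) + 1
  r_eq : ∀ v, v ≠ f →
    rAlt G M (gam G M f v) f v = rAlt G M (1 - gam G M f v) f (par v) + 1
  edge_mem : ∀ v, v ≠ f → (s(v, par v) ∈ M ↔ gam G M f v = 0)

/-- `c` is an ancestor of `x` in the tree `T` rooted at `f` (equivalently, for
`isAnc T f v w`: `w` belongs to the subtree `T_v`). -/
def isAnc (T : SimpleGraph V) (f c x : V) : Prop :=
  T.dist f c + T.dist c x = T.dist f x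

/-- The level-`k` edge set `F_k`. -/
def levelSet (G : SimpleGraph V) (M : Set (Sym2 V)) (f : V) (k : ℕ) : Set (Sym2 V) :=
  {e | e ∈ G.edgeSet ∧ ∃ u w : V, e = s(u, w) ∧
    ((e ∉ M ∧ max (rAlt G M 0 f u) (rAlt G M 0 f w) = (k : ℕ∞)) ∨
     (e ∈ M ∧ max (rAlt G M 1 f u) (rAlt G M 1 f w) = (k : ℕ∞)))}

/-- `F_{≤ k} = ⋃_{1 ≤ i ≤ k} F_i`. -/
def levelLe (G : SimpleGraph V) (M : Set (Sym2 V)) (f : V) (k : ℕ) : Set (Sym2 V) :=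
  {e | ∃ i, 1 ≤ i ∧ i ≤ k ∧ e ∈ levelSet G M f i}

/-- `G_k`: the spanning subgraph of `G` with edge set `E(T) ∪ F_{≤k}`. -/
def graphAt (T G : SimpleGraph V) (M : Set (Sym2 V)) (f : V) (k : ℕ) : SimpleGraph V :=
  SimpleGraph.fromEdgeSet (T.edgeSet ∪ levelLe G M f k)

/-- `B_k`: the set of bridges of `G_k`. -/
def Bset (T G : SimpleGraph V) (M : Set (Sym2 V)) (f : V) (k : ℕ) : Set (Sym2 V) :=
  {e | (graphAt T G M f k).IsBridge e}

/-- The edge set of the cycle `cyc(e)` formed by the non-tree edge `e = (u,w)` together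
with the path in `T` between `u` and `w`. -/
def cycEdges (T : SimpleGraph V) (u w : V) : Set (Sym2 V) :=
  insert s(u, w) {e | ∃ p : T.Walk u w, p.IsPath ∧ e ∈ p.edges}

/-- The partner function of a matching: an involution that swaps the endpoints of each edge of
the matching and fixes every unmatched node. -/
theorem IsMatching.exists_partner {V : Type*} {G : SimpleGraph V} {M : Set (Sym2 V)}
    (hM : IsMatching G M) :
    ∃ m : V → V, Function.Involutive m ∧ ∀ v w, s(v, w) ∈ M ↔ m v = w ∧ v ≠ w := by
  classical
  have huniq : ∀ v w w', s(v, w) ∈ M → s(v, w') ∈ M → w = w' := fun v w w' h h' =>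
    Sym2.congr_right.mp (hM.2 _ h _ h' v (Sym2.mem_mk_left _ _) (Sym2.mem_mk_left _ _))
  have hne : ∀ v w, s(v, w) ∈ M → v ≠ w := fun v w h => G.ne_of_adj (hM.1 h)
  let m : V → V := fun v => if h : ∃ w, s(v, w) ∈ M then h.choose else v
  have hm : ∀ v w, s(v, w) ∈ M ↔ m v = w ∧ v ≠ w := by
    intro v w
    by_cases h : ∃ w, s(v, w) ∈ M
    · have hv : m v = h.choose := dif_pos h
      constructor
      · intro hw
        exact ⟨hv.trans (huniq v _ _ h.choose_spec hw), hne v w hw⟩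
      · rintro ⟨rfl, -⟩
        rw [hv]
        exact h.choose_spec
    · have hv : m v = v := dif_neg h
      exact ⟨fun hw => absurd ⟨w, hw⟩ h, fun hw => absurd (hv.symm.trans hw.1) hw.2⟩
  refine ⟨m, fun v => ?_, hm⟩
  by_cases h : m v = v
  · rw [h, h]
  · have hv := (hm v (m v)).mpr ⟨rfl, Ne.symm h⟩
    rw [Sym2.eq_swap] at hv
    exact ((hm _ _).mp hv).1

theorem matched_iff_partner_ne {V : Type*} {M : Set (Sym2 V)} {m : V → V}
    (hm : ∀ v w, s(v, w) ∈ M ↔ m v = w ∧ v ≠ w) (v : V) : Matched M v ↔ m v ≠ v := by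
  constructor
  · rintro ⟨e, he, hv⟩
    obtain ⟨w, rfl⟩ := Sym2.mem_iff_exists.mp hv
    obtain ⟨h, hne⟩ := (hm v w).mp he
    rw [h]
    exact hne.symm
  · intro h
    exact ⟨_, (hm v (m v)).mpr ⟨rfl, h.symm⟩, Sym2.mem_mk_left _ _⟩

open Classical in
theorem IsMatching.card_partner_ne {V : Type*} [Fintype V] {G : SimpleGraph V}
    {M : Finset (Sym2 V)} (hM : IsMatching G (M : Set (Sym2 V))) {m : V → V}
    (hm : ∀ v w, s(v, w) ∈ (M : Set (Sym2 V)) ↔ m v = w ∧ v ≠ w) :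
    (Finset.univ.filter fun v => m v ≠ v).card = 2 * M.card := by
  have hU : (Finset.univ.filter fun v => m v ≠ v) = M.biUnion Sym2.toFinset := by
    ext v
    rw [Finset.mem_filter, ← matched_iff_partner_ne hm]
    simp [Matched]
  rw [hU, Finset.card_biUnion, Finset.sum_const_nat (m := 2), mul_comm]
  · intro e he
    exact Sym2.card_toFinset_of_not_isDiag e (G.not_isDiag_of_mem_edgeSet (hM.1 he))
  · intro e he e' he' hne
    refine Finset.disjoint_left.mpr fun v hv hv' => hne ?_
    exact hM.2 e he e' he' v (Sym2.mem_toFinset.mp hv) (Sym2.mem_toFinset.mp hv')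

/-- The sequence `f, n f, m (n f), n (m (n f)), …`. -/
def altSeq {V : Type*} (m n : V → V) (f : V) : ℕ → V
  | 0 => f
  | i + 1 => if Even i then n (altSeq m n f i) else m (altSeq m n f i)

section AltSeq

variable {V : Type*} {m n : V → V}

theorem altSeq_succ_of_even (f : V) {i : ℕ} (h : Even i) :
    altSeq m n f (i + 1) = n (altSeq m n f i) := by
  simp [altSeq, h]

theorem altSeq_succ_of_odd (f : V) {i : ℕ} (h : Odd i) :
    altSeq m n f (i + 1) = m (altSeq m n f i) := by
  simp [altSeq, Nat.not_even_iff_odd.mpr h]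

theorem altSeq_pred_eq (hm : Function.Involutive m) (hn : Function.Involutive n) {f f' : V}
    {a b : ℕ} (hab : Even a ↔ Even b)
    (h : altSeq m n f (a + 1) = altSeq m n f' (b + 1)) :
    altSeq m n f a = altSeq m n f' b := by
  by_cases ha : Even a
  · rw [altSeq_succ_of_even _ ha, altSeq_succ_of_even _ (hab.mp ha)] at h
    exact hn.injective h
  · have hb : ¬ Even b := fun hb => ha (hab.mpr hb)
    rw [altSeq_succ_of_odd _ (Nat.not_even_iff_odd.mp ha),
      altSeq_succ_of_odd _ (Nat.not_even_iff_odd.mp hb)] at h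
    exact hm.injective h

theorem altSeq_ne_of_parity_eq (hm : Function.Involutive m) (hn : Function.Involutive n)
    {f f' : V} (hf : m f = f) {a b : ℕ} (hab : a < b) (hpar : Even a ↔ Even b)
    (hb : ∀ i < b, altSeq m n f' (i + 1) ≠ altSeq m n f' i) :
    altSeq m n f a ≠ altSeq m n f' b := by
  induction a generalizing b with
  | zero =>
    intro h
    obtain ⟨c, rfl⟩ : ∃ c, b = c + 1 := ⟨b - 1, by omega⟩
    have hc : Odd c := by
      have := hpar.mp (by simp)
      rwa [Nat.even_add_one, Nat.not_even_iff_odd] at this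
    refine hb c (by omega) ?_
    have h1 := altSeq_succ_of_odd (m := m) (n := n) f' hc
    rw [← hm (altSeq m n f' c), ← h1, ← h]
    exact hf.symm
  | succ a ih =>
    intro h
    obtain ⟨c, rfl⟩ : ∃ c, b = c + 1 := ⟨b - 1, by omega⟩
    have hpar' : Even a ↔ Even c := by
      rw [Nat.even_add_one, Nat.even_add_one] at hpar
      exact not_iff_not.mp hpar
    exact ih (by omega) hpar' (fun i hi => hb i (by omega)) (altSeq_pred_eq hm hn hpar' h)

theorem altSeq_eq_of_parity_eq (hm : Function.Involutive m) (hn : Function.Involutive n)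
    {f f' : V} {a : ℕ} (h : altSeq m n f a = altSeq m n f' a) : f = f' := by
  induction a with
  | zero => exact h
  | succ a ih => exact ih (altSeq_pred_eq hm hn Iff.rfl h)

theorem altSeq_ne_of_parity_ne (hm : Function.Involutive m) (hn : Function.Involutive n)
    {f : V} {a d : ℕ}
    (hstep : ∀ i < a + (2 * d + 1), altSeq m n f (i + 1) ≠ altSeq m n f i) :
    altSeq m n f a ≠ altSeq m n f (a + (2 * d + 1)) := by
  induction d generalizing a with
  | zero => exact (hstep a (by omega)).symm
  | succ d ih =>
    intro h
    refine ih (a := a + 1) (fun i hi => hstep i (by omega)) ?_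
    have he : a + (2 * (d + 1) + 1) = (a + 1 + (2 * d + 1)) + 1 := by ring
    rw [he] at h
    by_cases ha : Even a
    · have hb : Even (a + 1 + (2 * d + 1)) := by
        obtain ⟨r, rfl⟩ := ha
        exact ⟨r + d + 1, by ring⟩
      rw [altSeq_succ_of_even _ ha, h, altSeq_succ_of_even _ hb, hn]
    · rw [Nat.not_even_iff_odd] at ha
      have hb : Odd (a + 1 + (2 * d + 1)) := by
        obtain ⟨r, rfl⟩ := ha
        exact ⟨r + d + 1, by ring⟩
      rw [altSeq_succ_of_odd _ ha, h, altSeq_succ_of_odd _ hb, hm]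

theorem altSeq_ne (hm : Function.Involutive m) (hn : Function.Involutive n)
    {f : V} (hf : m f = f) {a b : ℕ} (hab : a < b)
    (hstep : ∀ i < b, altSeq m n f (i + 1) ≠ altSeq m n f i) :
    altSeq m n f a ≠ altSeq m n f b := by
  by_cases hpar : Even a ↔ Even b
  · exact altSeq_ne_of_parity_eq hm hn hf hab hpar hstep
  · obtain ⟨d, rfl⟩ : ∃ d, b = a + (2 * d + 1) := by
      refine ⟨(b - a) / 2, ?_⟩
      simp only [Nat.even_iff] at hpar
      omega
    exact altSeq_ne_of_parity_ne hm hn hstep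

end AltSeq

theorem exists_walk_of_adj_succ {V : Type*} {G : SimpleGraph V} (x : ℕ → V) (L : ℕ)
    (hx : ∀ i < L, G.Adj (x i) (x (i + 1))) :
    ∃ p : G.Walk (x 0) (x L), p.length = L ∧ p.support = (List.range (L + 1)).map x ∧
      p.edges = (List.range L).map fun i => s(x i, x (i + 1)) := by
  induction L with
  | zero => exact ⟨Walk.nil, by simp⟩
  | succ L ih =>
    obtain ⟨p, hl, hs, he⟩ := ih fun i hi => hx i (by omega)
    refine ⟨p.concat (hx L (by omega)), by simp [hl], ?_, ?_⟩
    · rw [Walk.support_concat, hs, List.range_succ (n := L + 1)]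
      simp
    · rw [Walk.edges_concat, he, List.range_succ (n := L)]
      simp

/-- An alternating sequence that first stalls at an odd index traces an augmenting path. -/
theorem exists_isAugPath_of_altSeq {V : Type*} {G : SimpleGraph V} {M N : Set (Sym2 V)}
    (hM : M ⊆ G.edgeSet) (hN : N ⊆ G.edgeSet) {m n : V → V}
    (hm : Function.Involutive m) (hn : Function.Involutive n)
    (hmM : ∀ v w, s(v, w) ∈ M ↔ m v = w ∧ v ≠ w)
    (hnN : ∀ v w, s(v, w) ∈ N ↔ n v = w ∧ v ≠ w)
    {f : V} (hf : m f = f) {L : ℕ} (hL : Odd L)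
    (hstep : ∀ i < L, altSeq m n f (i + 1) ≠ altSeq m n f i)
    (hend : altSeq m n f (L + 1) = altSeq m n f L) :
    ∃ (a b : V) (p : G.Walk a b), IsAugPath G M p ∧ p.length = L := by
  have hinj : ∀ a b, a < b → b ≤ L → altSeq m n f a ≠ altSeq m n f b := fun a b hab hb =>
    altSeq_ne hm hn hf hab fun i hi => hstep i (by omega)
  have hodd : ∀ i < L, Odd i → s(altSeq m n f i, altSeq m n f (i + 1)) ∈ M := fun i hi ho =>
    (hmM _ _).mpr ⟨(altSeq_succ_of_odd f ho).symm, (hstep i hi).symm⟩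
  have heven : ∀ i < L, Even i → s(altSeq m n f i, altSeq m n f (i + 1)) ∉ M := by
    intro i hi hev hmem
    have h := ((hmM _ _).mp hmem).1
    rcases i with _ | i
    · exact hstep 0 hi (h.symm.trans hf)
    · have ho : Odd i := by
        rwa [Nat.even_add_one, Nat.not_even_iff_odd] at hev
      rw [altSeq_succ_of_odd f ho, hm] at h
      exact hinj i (i + 1 + 1) (by omega) (by omega) h
  have hadj : ∀ i < L, G.Adj (altSeq m n f i) (altSeq m n f (i + 1)) := by
    intro i hi
    rcases Nat.even_or_odd i with he | ho
    · exact hN ((hnN _ _).mpr ⟨(altSeq_succ_of_even f he).symm, (hstep i hi).symm⟩)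
    · exact hM (hodd i hi ho)
  obtain ⟨p, hl, hs, he⟩ := exists_walk_of_adj_succ (altSeq m n f) L hadj
  refine ⟨_, _, p, ⟨⟨?_, ?_⟩, hinj 0 L hL.pos le_rfl, ?_, ?_⟩, hl⟩
  · rw [Walk.isPath_def, hs]
    refine List.Nodup.map_on ?_ List.nodup_range
    intro a ha b hb hab
    rw [List.mem_range] at ha hb
    rcases lt_trichotomy a b with h | h | h
    · exact absurd hab (hinj a b h (by omega))
    · exact h
    · exact absurd hab.symm (hinj b a h (by omega))
  · intro i hi
    have hi' : i + 1 < L := by simpa [hl] using hi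
    simp only [List.get_eq_getElem, he, List.getElem_map, List.getElem_range]
    rcases Nat.even_or_odd i with hev | ho
    · exact iff_of_false (heven i (by omega) hev) (not_not.mpr (hodd _ hi' hev.add_one))
    · exact iff_of_true (hodd i (by omega) ho) (heven _ hi' ho.add_one)
  · rw [matched_iff_partner_ne hmM]
    exact not_not.mpr hf
  · rw [matched_iff_partner_ne hmM, ← altSeq_succ_of_odd (m := m) (n := n) f hL]
    exact not_not.mpr hend

open Classical in
/-- If no alternating sequence starting at a fixed point of `m` first stalls at an odd index
below `2 * T`, then each excess fixed point of `m` over `n` accounts for `T` non-fixed points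
of `m`. -/
theorem card_fixed_mul_le {V : Type*} [Fintype V] {m n : V → V}
    (hm : Function.Involutive m) (hn : Function.Involutive n) (T : ℕ)
    (hno : ∀ f, m f = f → ∀ L < 2 * T, Odd L →
      (∀ i < L, altSeq m n f (i + 1) ≠ altSeq m n f i) →
      altSeq m n f (L + 1) ≠ altSeq m n f L) :
    (Finset.univ.filter fun v => m v = v).card * T ≤
      (Finset.univ.filter fun v => n v = v).card * T +
        (Finset.univ.filter fun v => m v ≠ v).card := by
  set A := (Finset.univ.filter fun v => m v = v).filter
    fun f => ∀ i < 2 * T, altSeq m n f (i + 1) ≠ altSeq m n f i with hA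
  set B := (Finset.univ.filter fun v => m v = v).filter
    fun f => ¬ ∀ i < 2 * T, altSeq m n f (i + 1) ≠ altSeq m n f i with hB
  have hAB : A.card + B.card = (Finset.univ.filter fun v => m v = v).card :=
    Finset.card_filter_add_card_filter_not _
  have hlong : A.card * T ≤ (Finset.univ.filter fun v => m v ≠ v).card := by
    rw [← Finset.card_range T, ← Finset.card_product]
    refine Finset.card_le_card_of_injOn (fun q => altSeq m n q.1 (2 * q.2 + 1 + 1)) ?_ ?_
    · rintro ⟨f, j⟩ hq
      simp only [hA, Finset.coe_product, Set.mem_prod, Finset.mem_coe, Finset.mem_filter,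
        Finset.mem_univ, true_and, Finset.mem_range] at hq ⊢
      have ho : Odd (2 * j + 1) := odd_two_mul_add_one j
      have := hq.1.2 (2 * j + 1) (by omega)
      rw [altSeq_succ_of_odd f ho, hm, ← altSeq_succ_of_odd (m := m) (n := n) f ho]
      exact this.symm
    · rintro ⟨f, j⟩ hq ⟨f', j'⟩ hq' h
      simp only [hA, Finset.coe_product, Set.mem_prod, Finset.mem_coe, Finset.mem_filter,
        Finset.mem_univ, true_and, Finset.mem_range] at hq hq' h
      rcases lt_trichotomy j j' with hj | rfl | hj
      · exact absurd h (altSeq_ne_of_parity_eq hm hn hq.1.1 (by omega)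
          (by simp only [Nat.even_iff]; omega) fun i hi => hq'.1.2 i (by omega))
      · rw [altSeq_eq_of_parity_eq hm hn h]
      · exact absurd h.symm (altSeq_ne_of_parity_eq hm hn hq'.1.1 (by omega)
          (by simp only [Nat.even_iff]; omega) fun i hi => hq.1.2 i (by omega))
  have hshort : B.card ≤ (Finset.univ.filter fun v => n v = v).card := by
    have hstall : ∀ f ∈ B, ∃ L, Even L ∧ altSeq m n f (L + 1) = altSeq m n f L ∧
        ∀ i < L, altSeq m n f (i + 1) ≠ altSeq m n f i := by
      intro f hf
      simp only [hB, Finset.mem_filter, Finset.mem_univ, true_and, not_forall, not_not] at hf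
      obtain ⟨hf, i, hi, heq⟩ := hf
      have hex : ∃ i, altSeq m n f (i + 1) = altSeq m n f i := ⟨i, heq⟩
      have hmin : ∀ i < Nat.find hex, altSeq m n f (i + 1) ≠ altSeq m n f i :=
        fun i hi => Nat.find_min hex hi
      refine ⟨Nat.find hex, ?_, Nat.find_spec hex, hmin⟩
      by_contra hodd
      exact hno f hf _ ((Nat.find_min' hex heq).trans_lt hi) (Nat.not_even_iff_odd.mp hodd)
        hmin (Nat.find_spec hex)
    choose! L hev heq hmin using hstall
    refine Finset.card_le_card_of_injOn (fun f => altSeq m n f (L f)) ?_ ?_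
    · intro f hf
      have h := heq f hf
      rw [altSeq_succ_of_even f (hev f hf)] at h
      simpa using h
    · intro f hf f' hf' h
      have hfix : ∀ f ∈ B, m f = f := fun f hf => by
        simp only [hB, Finset.mem_filter, Finset.mem_univ, true_and] at hf
        exact hf.1
      have hpar : Even (L f) ↔ Even (L f') := iff_of_true (hev f hf) (hev f' hf')
      dsimp only at h
      rcases lt_trichotomy (L f) (L f') with hl | hl | hl
      · exact absurd h (altSeq_ne_of_parity_eq hm hn (hfix f hf) hl hpar (hmin f' hf'))
      · rw [hl] at h
        exact altSeq_eq_of_parity_eq hm hn h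
      · exact absurd h.symm
          (altSeq_ne_of_parity_eq hm hn (hfix f' hf') hl hpar.symm (hmin f hf))
  calc _ = B.card * T + A.card * T := by rw [← hAB]; ring
    _ ≤ _ := Nat.add_le_add (Nat.mul_le_mul_right T hshort) hlong

/-- Hopcroft–Karp: if `|M| ≤ s_max − k` (`k ≥ 1`), there is an augmenting path of
length strictly less than `⌊2·s_max/k⌋`. -/
theorem statement0 {V : Type*} [Fintype V] (G : SimpleGraph V)
    (M : Finset (Sym2 V)) (hM : IsMatching G ↑M) (smax : ℕ)
    (hsmax : IsGreatest {n : ℕ | ∃ N : Finset (Sym2 V), IsMatching G ↑N ∧ N.card = n} smax)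
    (k : ℕ) (hk : 1 ≤ k) (hcard : M.card + k ≤ smax) :
    ∃ (a b : V) (p : G.Walk a b), IsAugPath G ↑M p ∧ p.length < 2 * smax / k := by
  classical
  obtain ⟨⟨N, hN, hNcard⟩, -⟩ := hsmax
  obtain ⟨m, hm, hmM⟩ := hM.exists_partner
  obtain ⟨n, hn, hnN⟩ := hN.exists_partner
  by_contra hcon
  have hle := card_fixed_mul_le hm hn (M.card / k + 1) fun f hf L hL hodd hstep hend => by
    obtain ⟨a, b, p, hp, hlen⟩ :=
      exists_isAugPath_of_altSeq hM.1 hN.1 hm hn hmM hnN hf hodd hstep hend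
    refine hcon ⟨a, b, p, hp, ?_⟩
    rw [hlen, ← Nat.succ_le_iff, Nat.le_div_iff_mul_le hk]
    calc (L + 1) * k ≤ (2 * (M.card / k + 1)) * k := Nat.mul_le_mul_right k hL
      _ = 2 * (M.card / k * k + k) := by ring
      _ ≤ 2 * smax := by have := Nat.div_mul_le_self M.card k; omega
  have hMc := hM.card_partner_ne hmM
  have hNc := hN.card_partner_ne hnN
  have hMs := Finset.card_filter_add_card_filter_not (s := Finset.univ) fun v => m v = v
  have hNs := Finset.card_filter_add_card_filter_not (s := Finset.univ) fun v => n v = v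
  simp only [← ne_eq] at hMs hNs
  have hexc : (Finset.univ.filter fun v => n v = v).card + 2 * k ≤
      (Finset.univ.filter fun v => m v = v).card := by omega
  have hlt : M.card < k * (M.card / k + 1) := Nat.lt_mul_div_succ M.card hk
  have hmul := Nat.mul_le_mul_right (M.card / k + 1) hexc
  rw [add_mul, mul_assoc] at hmul
  omega

end MM
end

section
/- Let M be a matching of a finite simple graph G and f an unmatched node such that every node of G is 0-reachable or 1-reachable from f in G. Then there exists an alternating base tree for (G, M, f). -/
namespace MM

open SimpleGraph

variable {V : Type*}

/-- The graph joining every `v ≠ f` to `par v`. -/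
def parentGraph (f : V) (par : V → V) : SimpleGraph V :=
  SimpleGraph.fromRel fun v u => v ≠ f ∧ u = par v

section ParentGraph

variable {f : V} {par : V → V} {rank : V → ℕ}

lemma parentGraph_adj (hrank : ∀ v, v ≠ f → rank (par v) < rank v) {v : V} (hv : v ≠ f) :
    (parentGraph f par).Adj v (par v) := by
  refine (SimpleGraph.fromRel_adj _ _ _).2 ⟨fun h => ?_, Or.inl ⟨hv, rfl⟩⟩
  exact (hrank v hv).ne (congrArg rank h.symm)

lemma parentGraph_connected (hrank : ∀ v, v ≠ f → rank (par v) < rank v) :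
    (parentGraph f par).Connected := by
  have key : ∀ n v, rank v = n → (parentGraph f par).Reachable f v := by
    intro n
    induction n using Nat.strong_induction_on with
    | _ n ih =>
      intro v hn
      by_cases hv : v = f
      · rw [hv]
      · exact (ih _ (hn ▸ hrank v hv) _ rfl).trans (parentGraph_adj hrank hv).symm.reachable
  exact (SimpleGraph.connected_iff _).2 ⟨fun u v => (key _ u rfl).symm.trans (key _ v rfl), ⟨f⟩⟩

lemma parentGraph_isTree [Finite V] (hrank : ∀ v, v ≠ f → rank (par v) < rank v) :
    (parentGraph f par).IsTree := by
  have hconn := parentGraph_connected hrank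
  refine SimpleGraph.isTree_iff_connected_and_card.2
    ⟨hconn, le_antisymm ?_ hconn.card_vert_le_card_edgeSet_add_one⟩
  have hsub : (parentGraph f par).edgeSet ⊆ (fun v => s(v, par v)) '' {v | v ≠ f} := by
    intro e
    induction e with
    | _ u v =>
      intro huv
      obtain ⟨-, ⟨h, h'⟩ | ⟨h, h'⟩⟩ := (SimpleGraph.fromRel_adj _ _ _).1 ((SimpleGraph.mem_edgeSet _).1 huv)
      · exact ⟨u, h, by rw [h']⟩
      · exact ⟨v, h, by rw [h', Sym2.eq_swap]⟩
  have hcard := (Set.ncard_le_ncard hsub (Set.toFinite _)).trans (Set.ncard_image_le (Set.toFinite _))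
  have hcompl : ({v | v ≠ f} : Set V).ncard + 1 = Nat.card V := by
    rw [← Set.ncard_add_ncard_compl {v : V | v ≠ f}]
    simp [Set.compl_ofPred]
  rw [Nat.card_coe_set_eq]
  omega

lemma exists_depth (hrank : ∀ v, v ≠ f → rank (par v) < rank v) :
    ∃ depth : V → ℕ, depth f = 0 ∧ ∀ v, v ≠ f → depth v = depth (par v) + 1 := by
  classical
  have hex : ∀ v, ∃ n, par^[n] v = f := by
    have key : ∀ m v, rank v = m → ∃ n, par^[n] v = f := by
      intro m
      induction m using Nat.strong_induction_on with
      | _ m ih =>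
        intro v hm
        by_cases hv : v = f
        · exact ⟨0, hv⟩
        · obtain ⟨n, hn⟩ := ih _ (hm ▸ hrank v hv) _ rfl
          exact ⟨n + 1, hn⟩
    exact fun v => key _ v rfl
  refine ⟨fun v => Nat.find (hex v), by simp, fun v hv => ?_⟩
  exact Nat.find_comp_succ (hex v) (hex (par v)) hv

lemma parentGraph_dist (hrank : ∀ v, v ≠ f → rank (par v) < rank v) {v : V} (hv : v ≠ f) :
    (parentGraph f par).dist f v = (parentGraph f par).dist f (par v) + 1 := by
  obtain ⟨depth, hf, hdepth⟩ := exists_depth hrank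
  have hconn := parentGraph_connected hrank
  have hle : ∀ n v, depth v = n → (parentGraph f par).dist f v ≤ n := by
    intro n
    induction n with
    | zero =>
      intro v hn
      have hv : v = f := by
        by_contra hv
        have := hdepth v hv
        omega
      simp [hv]
    | succ n ih =>
      intro v hn
      have hv : v ≠ f := by
        rintro rfl
        omega
      have h₁ := ih (par v) (by have := hdepth v hv; omega)
      have h₂ := hconn.dist_triangle (u := f) (v := par v) (w := v)
      rw [SimpleGraph.dist_eq_one_iff_adj.2 (parentGraph_adj hrank hv).symm] at h₂
      omega
  have hwalk : ∀ {u v : V} (p : (parentGraph f par).Walk u v), depth v ≤ depth u + p.length := by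
    intro u v p
    induction p with
    | nil => simp
    | cons h p ih =>
      rw [SimpleGraph.Walk.length_cons]
      obtain ⟨-, ⟨h, rfl⟩ | ⟨h, rfl⟩⟩ := h <;> have := hdepth _ h <;> omega
  have heq : ∀ v, (parentGraph f par).dist f v = depth v := by
    intro v
    refine le_antisymm (hle _ v rfl) ?_
    obtain ⟨p, hp⟩ := hconn.exists_walk_length_eq_dist f v
    have := hwalk p
    omega
  rw [heq, heq, hdepth v hv]

end ParentGraph

section Alternation

variable {G : SimpleGraph V} {M : Set (Sym2 V)} {f u v : V}

lemma AltList.of_prefix {l l' : List (Sym2 V)} (hl : AltList M l) (h : l' <+: l) :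
    AltList M l' := by
  obtain ⟨t, rfl⟩ := h
  intro i hi
  have := hl i (by simp; omega)
  simpa [List.getElem_append_left, hi, Nat.lt_of_succ_lt hi] using this

/-- A list of edges starting with a non-matching edge alternates iff exactly its edges in odd
positions are matching edges. -/
lemma altList_iff {l : List (Sym2 V)} (h₀ : ∀ h : 0 < l.length, l[0] ∉ M) :
    AltList M l ↔ ∀ (i : ℕ) (h : i < l.length), l[i] ∈ M ↔ i % 2 = 1 := by
  constructor
  · intro hl i
    induction i with
    | zero => intro h; simpa using h₀ h
    | succ i ih =>
      intro h
      have h₁ := ih (by omega)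
      have h₂ := hl i h
      simp only [List.get_eq_getElem] at h₂
      by_cases hi : l[i + 1] ∈ M
      · have : ¬ i % 2 = 1 := fun h => h₂.1 (h₁.2 h) hi
        simp only [hi, true_iff]
        omega
      · have := h₁.1 (h₂.2 hi)
        simp only [hi, false_iff]
        omega
  · intro hl i h
    simp only [List.get_eq_getElem]
    rw [hl, hl]
    omega

lemma notMem_of_getElem_zero_edges (hf : ¬ Matched M f) (p : G.Walk f v)
    (h : 0 < p.edges.length) : p.edges[0] ∉ M := by
  cases p with
  | nil => simp at h
  | cons hadj p => exact fun hmem => hf ⟨_, hmem, by simp⟩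

lemma isAltPath_concat_iff (hf : ¬ Matched M f) (p : G.Walk f u) (h : G.Adj u v) :
    IsAltPath M (p.concat h) ↔
      IsAltPath M p ∧ v ∉ p.support ∧ (s(u, v) ∈ M ↔ p.length % 2 = 1) := by
  unfold IsAltPath
  rw [SimpleGraph.Walk.concat_isPath_iff, altList_iff (notMem_of_getElem_zero_edges hf _),
    altList_iff (notMem_of_getElem_zero_edges hf _)]
  simp only [SimpleGraph.Walk.edges_concat, List.concat_eq_append]
  constructor
  · rintro ⟨⟨hp, hv⟩, halt⟩
    refine ⟨⟨hp, fun i hi => ?_⟩, hv, ?_⟩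
    · have := halt i (by simp at hi ⊢; omega)
      rwa [List.getElem_append_left hi] at this
    · have := halt p.edges.length (by simp)
      simpa using this
  · rintro ⟨⟨hp, halt⟩, hv, hlast⟩
    refine ⟨⟨hp, hv⟩, fun i hi => ?_⟩
    by_cases h' : i < p.edges.length
    · rw [List.getElem_append_left h']
      exact halt i h'
    · obtain rfl : i = p.length := by simp at h' hi; omega
      simpa using hlast

lemma rAlt_le {θ : ℕ} {p : G.Walk f v} (hp : IsAltPath M p) (hθ : p.length % 2 = θ) :
    rAlt G M θ f v ≤ p.length :=
  sInf_le ⟨p, hp, hθ, rfl⟩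

lemma le_rAlt {θ n : ℕ}
    (h : ∀ q : G.Walk f v, IsAltPath M q → q.length % 2 = θ → n ≤ q.length) :
    (n : ℕ∞) ≤ rAlt G M θ f v := by
  refine le_sInf ?_
  rintro _ ⟨q, hq, hθ, rfl⟩
  exact_mod_cast h q hq hθ

lemma rAlt_eq {θ : ℕ} {p : G.Walk f v} (hp : IsAltPath M p) (hθ : p.length % 2 = θ)
    (hmin : ∀ q : G.Walk f v, IsAltPath M q → q.length % 2 = θ → p.length ≤ q.length) :
    rAlt G M θ f v = p.length :=
  le_antisymm (rAlt_le hp hθ) (le_rAlt hmin)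

/-- `γ(v)` is the parity of a shortest alternating path from `f` to `v`. -/
lemma gam_eq {p : G.Walk f v} (hp : IsAltPath M p)
    (hmin : ∀ q : G.Walk f v, IsAltPath M q → p.length ≤ q.length) :
    gam G M f v = p.length % 2 := by
  unfold gam
  obtain h | h := Nat.mod_two_eq_zero_or_one p.length
  · rw [h, if_pos]
    rw [rAlt_eq hp h fun q hq _ => hmin q hq]
    exact le_rAlt fun q hq _ => hmin q hq
  · rw [h, if_neg]
    rw [rAlt_eq hp h fun q hq _ => hmin q hq, not_le]
    refine lt_of_lt_of_le ?_ (le_rAlt (n := p.length + 1) fun q hq hθ => ?_)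
    · exact_mod_cast Nat.lt_succ_self _
    · have := hmin q hq
      omega

lemma IsAltPath.takeUntil [DecidableEq V] {p : G.Walk f u} (hp : IsAltPath M p)
    (h : v ∈ p.support) : IsAltPath M (p.takeUntil v h) :=
  ⟨hp.1.takeUntil h, hp.2.of_prefix (p.edges_takeUntil_prefix_edges h)⟩

lemma exists_shortest_altPath (h : ∃ p : G.Walk f v, IsAltPath M p) :
    ∃ p : G.Walk f v, IsAltPath M p ∧ ∀ q : G.Walk f v, IsAltPath M q → p.length ≤ q.length := by
  classical
  have hex : ∃ n, ∃ p : G.Walk f v, IsAltPath M p ∧ p.length = n := by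
    obtain ⟨p, hp⟩ := h
    exact ⟨_, p, hp, rfl⟩
  obtain ⟨p, hp, hlen⟩ := Nat.find_spec hex
  exact ⟨p, hp, fun q hq => hlen ▸ Nat.find_min' hex ⟨q, hq, rfl⟩⟩

/-- The part of a shortest alternating path before its last edge is shortest among the alternating
paths of the same parity. -/
lemma length_le_of_concat_shortest (hf : ¬ Matched M f) {p : G.Walk f u} {h : G.Adj u v}
    (hp : IsAltPath M (p.concat h))
    (hmin : ∀ q : G.Walk f v, IsAltPath M q → (p.concat h).length ≤ q.length)
    (q : G.Walk f u) (hq : IsAltPath M q) (hθ : q.length % 2 = p.length % 2) :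
    p.length ≤ q.length := by
  classical
  rw [SimpleGraph.Walk.length_concat] at hmin
  by_cases hv : v ∈ q.support
  · have h₁ := hmin _ (hq.takeUntil hv)
    have h₂ := q.length_takeUntil_le_length hv
    omega
  · have h₁ := hmin (q.concat h) <| (isAltPath_concat_iff hf q h).2
      ⟨hq, hv, hθ ▸ ((isAltPath_concat_iff hf p h).1 hp).2.2⟩
    rw [SimpleGraph.Walk.length_concat] at h₁
    omega

end Alternation

/-- If every node is 0-reachable or 1-reachable from the unmatched node `f`,
then an alternating base tree for `(G, M, f)` exists. -/
theorem statement3 {V : Type*} [Fintype V] (G : SimpleGraph V) (M : Set (Sym2 V))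
    (hM : IsMatching G M) (f : V) (hf : ¬ Matched M f)
    (hreach : ∀ v, ThetaReach G M 0 f v ∨ ThetaReach G M 1 f v) :
    ∃ (T : SimpleGraph V) (par : V → V), AltBaseTree G M f T par := by
  choose sp hsp hmin using fun v =>
    exists_shortest_altPath ((hreach v).elim (fun ⟨p, hp, _⟩ => ⟨p, hp⟩) fun ⟨p, hp, _⟩ => ⟨p, hp⟩)
  have hpar : ∀ v, ∃ u, v ≠ f → ∃ (p : G.Walk f u) (h : G.Adj u v), sp v = p.concat h := by
    intro v
    by_cases hv : v = f
    · exact ⟨f, fun h => absurd hv h⟩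
    · obtain ⟨w, h, q, hq⟩ := SimpleGraph.Walk.exists_eq_cons_of_ne (Ne.symm hv) (sp v)
      obtain ⟨u, p, h', hp⟩ := SimpleGraph.Walk.exists_cons_eq_concat h q
      exact ⟨u, fun _ => ⟨p, h', hq.trans hp⟩⟩
  choose par hpar using hpar
  have hrank : ∀ v, v ≠ f → (sp (par v)).length < (sp v).length := by
    intro v hv
    obtain ⟨p, h, hp⟩ := hpar v hv
    have halt := (isAltPath_concat_iff hf p h).1 (hp ▸ hsp v)
    rw [hp, SimpleGraph.Walk.length_concat]
    exact Nat.lt_succ_of_le (hmin _ p halt.1)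
  have hdist := fun v (hv : v ≠ f) =>
    parentGraph_dist (rank := fun v => (sp v).length) hrank hv
  refine ⟨parentGraph f par, par, ?_, parentGraph_isTree (rank := fun v => (sp v).length) hrank,
    fun v hv => parentGraph_adj (rank := fun v => (sp v).length) hrank hv, hdist, ?_, ?_⟩
  · rintro u v ⟨-, ⟨h, rfl⟩ | ⟨h, rfl⟩⟩
    · exact (hpar u h).choose_spec.choose.symm
    · exact (hpar v h).choose_spec.choose
  · intro v hv
    obtain ⟨p, h, hp⟩ := hpar v hv
    have halt := hsp v
    have hmin' := hmin v
    rw [hp] at halt hmin'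
    have hpalt := ((isAltPath_concat_iff hf p h).1 halt).1
    rw [gam_eq halt hmin', rAlt_eq halt rfl fun q hq _ => hmin' q hq]
    have hmod : 1 - (p.concat h).length % 2 = p.length % 2 := by
      rw [SimpleGraph.Walk.length_concat]
      omega
    rw [hmod, rAlt_eq hpalt rfl (length_le_of_concat_shortest hf halt hmin'),
      SimpleGraph.Walk.length_concat]
    push_cast
    rfl
  · intro v hv
    obtain ⟨p, h, hp⟩ := hpar v hv
    have halt := hsp v
    have hmin' := hmin v
    rw [hp] at halt hmin'
    rw [gam_eq halt hmin', Sym2.eq_swap, ((isAltPath_concat_iff hf p h).1 halt).2.2,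
      SimpleGraph.Walk.length_concat]
    omega

end MM
end

section
/- Let T be an alternating base tree for (G, M, f), and let v ≠ f be a node with γ(v) = θ and r^θ_G(f,v) = k+1. Then every node w of the subtree T_v satisfies r_G(f,w) ≥ k+1; consequently no edge of F_{≤k} has exactly one endpoint in V(T_v), and ep(v) is a bridge of the graph G_k. -/
namespace MM

open SimpleGraph

variable {V : Type*}

/-- In a tree, a vertex has at most one neighbour closer to the root. -/
lemma eq_of_adj_of_dist_eq_add_one {V : Type*} {T : SimpleGraph V} (hT : T.IsTree) {f x y z : V}
    (hxy : T.Adj x y) (hxz : T.Adj x z) (hy : T.dist f x = T.dist f y + 1)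
    (hz : T.dist f x = T.dist f z + 1) : y = z := by
  obtain ⟨p, hp⟩ := hT.connected.exists_walk_length_eq_dist y f
  obtain ⟨q, hq⟩ := hT.connected.exists_walk_length_eq_dist z f
  have hp' : (Walk.cons hxy p).IsPath := Walk.isPath_of_length_eq_dist _ (by
    rw [Walk.length_cons, hp, dist_comm, dist_comm (u := x), hy])
  have hq' : (Walk.cons hxz q).IsPath := Walk.isPath_of_length_eq_dist _ (by
    rw [Walk.length_cons, hq, dist_comm, dist_comm (u := x), hz])
  have h := (hT.existsUnique_path x f).unique hp' hq'
  injection h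

lemma rMin_eq_rAlt_gam {V : Type*} (G : SimpleGraph V) (M : Set (Sym2 V)) (f v : V) :
    rMin G M f v = rAlt G M (gam G M f v) f v := by
  unfold rMin gam
  split_ifs with h
  · exact min_eq_left h
  · exact min_eq_right (not_le.mp h).le

lemma isAnc_self {V : Type*} (T : SimpleGraph V) (f v : V) : isAnc T f v v := by
  simp [isAnc]

namespace AltBaseTree

variable {V : Type*} {G : SimpleGraph V} {M : Set (Sym2 V)} {f : V} {T : SimpleGraph V}
  {par : V → V}

/-- Every tree edge joins a vertex to its parent. -/
lemma eq_par_of_adj (h : AltBaseTree G M f T par) {x y : V} (hxy : T.Adj x y) :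
    x ≠ f ∧ y = par x ∨ y ≠ f ∧ x = par y := by
  have aux : ∀ {a b : V}, T.Adj a b → T.dist f a = T.dist f b + 1 → a ≠ f ∧ b = par a := by
    intro a b hab hd
    have ha : a ≠ f := by
      rintro rfl
      simp at hd
    exact ⟨ha, eq_of_adj_of_dist_eq_add_one h.tree hab (h.adj a ha) hd (h.parent_dist a ha)⟩
  rcases h.tree.dist_eq_dist_add_one_of_adj f hxy with hd | hd
  · exact Or.inl (aux hxy hd)
  · exact Or.inr (aux hxy.symm hd)

lemma isAnc_par_iff (h : AltBaseTree G M f T par) {v x : V} (hx : x ≠ f) (hxv : x ≠ v) :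
    isAnc T f v (par x) ↔ isAnc T f v x := by
  have hpx := h.parent_dist x hx
  unfold isAnc
  constructor
  · intro hp
    have h1 := h.tree.connected.dist_triangle (u := f) (v := v) (w := x)
    have h2 := h.tree.connected.dist_triangle (u := v) (v := par x) (w := x)
    have h3 : T.dist (par x) x = 1 := dist_eq_one_iff_adj.mpr (h.adj x hx).symm
    omega
  · intro ha
    obtain ⟨p, hp⟩ := h.tree.connected.exists_walk_length_eq_dist x v
    cases p with
    | nil => exact absurd rfl hxv
    | @cons _ y _ hxy q =>
      rw [Walk.length_cons, dist_comm] at hp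
      have h1 : T.dist v y ≤ q.length := dist_comm (G := T) ▸ dist_le q
      have h2 := h.tree.connected.dist_triangle (u := f) (v := v) (w := y)
      rcases h.tree.dist_eq_dist_add_one_of_adj f hxy with hd | hd
      · obtain rfl :=
          eq_of_adj_of_dist_eq_add_one h.tree hxy (h.adj x hx) hd hpx
        omega
      · omega

lemma not_isAnc_par (h : AltBaseTree G M f T par) {v : V} (hv : v ≠ f) :
    ¬ isAnc T f v (par v) := by
  have := h.parent_dist v hv
  unfold isAnc
  omega

lemma rMin_par_add_one_le (h : AltBaseTree G M f T par) {w : V} (hw : w ≠ f) :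
    rMin G M f (par w) + 1 ≤ rMin G M f w := by
  rw [rMin_eq_rAlt_gam G M f w, h.r_eq w hw]
  gcongr
  unfold rMin gam
  split_ifs
  · exact min_le_right _ _
  · exact min_le_left _ _

/-- The distance `r_G` does not decrease when descending the base tree. -/
lemma rMin_le_of_isAnc (h : AltBaseTree G M f T par) {v w : V} (ha : isAnc T f v w) :
    rMin G M f v ≤ rMin G M f w := by
  induction hn : T.dist f w generalizing w with
  | zero =>
    have hv : T.dist v w = 0 := by unfold isAnc at ha; omega
    rw [h.tree.connected.dist_eq_zero_iff.mp hv]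
  | succ n ih =>
    by_cases hwv : w = v
    · rw [hwv]
    have hwf : w ≠ f := by
      rintro rfl
      simp at hn
    have := h.parent_dist w hwf
    calc rMin G M f v ≤ rMin G M f (par w) :=
          ih ((h.isAnc_par_iff hwf hwv).mpr ha) (by omega)
      _ ≤ rMin G M f (par w) + 1 := le_self_add
      _ ≤ rMin G M f w := h.rMin_par_add_one_le hwf

end AltBaseTree

/-- Both endpoints of an edge of `F_{≤ k}` have `r_G ≤ k`. -/
lemma rMin_le_of_mem_levelLe {V : Type*} {G : SimpleGraph V} {M : Set (Sym2 V)} {f : V} {k : ℕ}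
    {e : Sym2 V} (he : e ∈ levelLe G M f k) {x : V} (hx : x ∈ e) :
    rMin G M f x ≤ (k : ℕ∞) := by
  obtain ⟨i, -, hik, -, u, w, rfl, h⟩ := he
  refine le_trans ?_ (Nat.cast_le.mpr hik)
  rcases h with ⟨-, h⟩ | ⟨-, h⟩ <;> rw [← h] <;> rcases Sym2.mem_iff.mp hx with rfl | rfl <;>
    simp [rMin]

/-- If `γ(v) = θ` and `r^θ_G(f,v) = k+1`, then every node of the subtree `T_v` has
`r_G ≥ k+1`, no edge of `F_{≤k}` has exactly one endpoint in `V(T_v)`, and `ep(v)` is a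
bridge of `G_k`. -/
theorem statement5 {V : Type*} [Fintype V] (G : SimpleGraph V) (M : Set (Sym2 V))
    (hM : IsMatching G M) (f : V) (hf : ¬ Matched M f)
    (hreach : ∀ x, ThetaReach G M 0 f x ∨ ThetaReach G M 1 f x)
    (T : SimpleGraph V) (par : V → V) (habt : AltBaseTree G M f T par)
    (v : V) (hv : v ≠ f) (θ k : ℕ) (hθ : θ ≤ 1)
    (hγ : gam G M f v = θ) (hr : rAlt G M θ f v = ((k + 1 : ℕ) : ℕ∞)) :
    (∀ w, isAnc T f v w → ((k + 1 : ℕ) : ℕ∞) ≤ rMin G M f w) ∧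
    (∀ u w : V, s(u, w) ∈ levelLe G M f k → (isAnc T f v u ↔ isAnc T f v w)) ∧
    (graphAt T G M f k).IsBridge s(v, par v) := by
  have hsub : ∀ w, isAnc T f v w → ((k + 1 : ℕ) : ℕ∞) ≤ rMin G M f w := by
    intro w hw
    rw [← hr, ← hγ, ← rMin_eq_rAlt_gam]
    exact habt.rMin_le_of_isAnc hw
  have hout : ∀ e ∈ levelLe G M f k, ∀ x ∈ e, ¬ isAnc T f v x := by
    intro e he x hx ha
    have := Nat.cast_le.mp ((hsub x ha).trans (rMin_le_of_mem_levelLe he hx))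
    omega
  have hlevel : ∀ u w : V, s(u, w) ∈ levelLe G M f k → (isAnc T f v u ↔ isAnc T f v w) :=
    fun u w he => iff_of_false (hout _ he u (Sym2.mem_mk_left u w))
      (hout _ he w (Sym2.mem_mk_right u w))
  refine ⟨hsub, hlevel, ?_⟩
  rw [isBridge_iff]
  rintro ⟨p⟩
  have hstep : ∀ x y : V, ((graphAt T G M f k).deleteEdges {s(v, par v)}).Adj x y →
      (isAnc T f v x ↔ isAnc T f v y) := by
    intro x y hxy
    obtain ⟨hxy, hne⟩ := deleteEdges_adj.mp hxy
    rw [graphAt, fromEdgeSet_adj] at hxy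
    rcases hxy.1 with hT | hF
    · rcases habt.eq_par_of_adj (x := x) (y := y) hT with ⟨hx, rfl⟩ | ⟨hy, rfl⟩
      · exact (habt.isAnc_par_iff hx (by rintro rfl; exact hne rfl)).symm
      · exact habt.isAnc_par_iff hy (by rintro rfl; exact hne Sym2.eq_swap)
    · exact hlevel x y hF
  have hwalk : ∀ {x y : V}, ((graphAt T G M f k).deleteEdges {s(v, par v)}).Walk x y →
      (isAnc T f v x ↔ isAnc T f v y) := by
    intro x y q
    induction q with
    | nil => rfl
    | cons h _ ih => exact (hstep _ _ h).trans ih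
  exact habt.not_isAnc_par hv ((hwalk p).mp (isAnc_self T f v))

end MM
end

section
/- Let T be an alternating base tree for (G, M, f). For each 1 ≤ i ≤ k let F^c_i ⊆ F_i ∖ E(T) be a set of non-tree edges such that B_{i−1} ∖ B_i ⊆ ∪_{e ∈ F^c_i} E(cyc(e)). Then the spanning subgraph H_k with edge set E(T) ∪ (∪_{1≤i≤k} F^c_i) preserves the reachability of G_k: for every node v and every θ ∈ {0,1}, if v is θ-reachable in G_k then v is θ-reachable in H_k. -/
namespace MM

open SimpleGraph

variable {V : Type*}

/-- `AltFrom H M f n x S`: there is a simple path in `H` from `f` to `x` of length `n` with vertex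
set `S`, whose edges alternate between non-members and members of `M`, starting with a
non-member. -/
inductive AltFrom {V : Type*} (H : SimpleGraph V) (M : Set (Sym2 V)) (f : V) :
    ℕ → V → Set V → Prop
  | nil : AltFrom H M f 0 f {f}
  | snoc {n : ℕ} {x y : V} {S : Set V} : AltFrom H M f n x S → H.Adj x y → y ∉ S →
      (s(x, y) ∈ M ↔ n % 2 = 1) → AltFrom H M f (n + 1) y (insert y S)

/-- Reachability from `f` by an alternating path of length exactly `n`. -/
def ReachLen {V : Type*} (H : SimpleGraph V) (M : Set (Sym2 V)) (f : V) (n : ℕ) (x : V) : Prop :=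
  ∃ S, AltFrom H M f n x S

/-- Reachability from `f` by an alternating path whose length has the parity of `n`. -/
def ReachPar {V : Type*} (H : SimpleGraph V) (M : Set (Sym2 V)) (f : V) (n : ℕ) (x : V) : Prop :=
  ∃ m, m % 2 = n % 2 ∧ ReachLen H M f m x

section AltFrom

variable {V : Type*} {H K : SimpleGraph V} {M : Set (Sym2 V)} {f : V}

lemma AltFrom.mono (hHK : H ≤ K) {n : ℕ} {x : V} {S : Set V} (h : AltFrom H M f n x S) :
    AltFrom K M f n x S := by
  induction h with
  | nil => exact .nil
  | snoc _ hadj hy hp ih => exact .snoc ih (hHK hadj) hy hp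

lemma ReachPar.mono (hHK : H ≤ K) {n : ℕ} {x : V} (h : ReachPar H M f n x) :
    ReachPar K M f n x := by
  obtain ⟨m, hm, S, hS⟩ := h
  exact ⟨m, hm, S, hS.mono hHK⟩

lemma ReachPar.congr {m n : ℕ} {x : V} (hmn : m % 2 = n % 2) (h : ReachPar H M f m x) :
    ReachPar H M f n x := by
  obtain ⟨l, hl, h⟩ := h
  exact ⟨l, hl.trans hmn, h⟩

lemma AltFrom.root_mem {n : ℕ} {x : V} {S : Set V} (h : AltFrom H M f n x S) : f ∈ S := by
  induction h with
  | nil => rfl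
  | snoc _ _ _ _ ih => exact Set.mem_insert_of_mem _ ih

lemma AltFrom.end_mem {n : ℕ} {x : V} {S : Set V} (h : AltFrom H M f n x S) : x ∈ S := by
  cases h with
  | nil => rfl
  | snoc => exact Set.mem_insert _ _

lemma ReachLen.eq_zero {n : ℕ} (h : ReachLen H M f n f) : n = 0 := by
  obtain ⟨S, h⟩ := h
  cases h with
  | nil => rfl
  | snoc h _ hy _ => exact absurd h.root_mem hy

lemma ReachLen.eq_root {x : V} (h : ReachLen H M f 0 x) : x = f := by
  obtain ⟨S, h⟩ := h
  cases h
  rfl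

/-- Every vertex of an alternating path other than its end is reached by a shorter prefix. -/
lemma AltFrom.exists_prefix {n : ℕ} {x : V} {S : Set V} (h : AltFrom H M f n x S) :
    ∀ w ∈ S, w = x ∨ ∃ m < n, ReachLen H M f m w := by
  induction h with
  | nil => exact fun w hw => Or.inl hw
  | @snoc n x y S h _ _ _ ih =>
    rintro w (rfl | hw)
    · exact Or.inl rfl
    · rcases ih w hw with rfl | ⟨m, hm, hr⟩
      · exact Or.inr ⟨n, Nat.lt_succ_self n, S, h⟩
      · exact Or.inr ⟨m, hm.trans (Nat.lt_succ_self n), hr⟩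

/-- If `s(p, v)` is the only edge of `H` entering `C`, a path from outside `C` that ends outside
`C` avoids `C`, and one that ends in `C` visits both `p` and `v`. -/
lemma AltFrom.avoid {C : Set V} {p v : V}
    (hC : ∀ x y, H.Adj x y → x ∉ C → y ∈ C → x = p ∧ y = v) (hf : f ∉ C)
    {n : ℕ} {x : V} {S : Set V} (h : AltFrom H M f n x S) :
    (x ∉ C → ∀ w ∈ S, w ∉ C) ∧ (x ∈ C → p ∈ S ∧ v ∈ S) := by
  induction h with
  | nil => exact ⟨fun _ w hw => by rw [Set.mem_singleton_iff.1 hw]; exact hf, fun h => absurd h hf⟩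
  | @snoc n x y S h hadj hy _ ih =>
    constructor
    · intro hyC
      by_cases hx : x ∈ C
      · obtain ⟨rfl, rfl⟩ := hC y x hadj.symm hyC hx
        exact absurd (ih.2 hx).1 hy
      · rintro w (rfl | hw)
        · exact hyC
        · exact ih.1 hx w hw
    · intro hyC
      by_cases hx : x ∈ C
      · exact ⟨.inr (ih.2 hx).1, .inr (ih.2 hx).2⟩
      · obtain ⟨rfl, rfl⟩ := hC x y hadj hx hyC
        exact ⟨.inr h.end_mem, .inl rfl⟩

/-- If `s(p, v)` is the only edge of `H` entering `C`, an alternating path reaching `y ∈ C` in `H`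
can be traversed backwards from `y` to `v` inside `C`, extending an alternating path that
arrives at `y` with an edge of the appropriate kind. -/
lemma AltFrom.reverse_glue {C : Set V} {p v : V}
    (hC : ∀ x y, H.Adj x y → x ∉ C → y ∈ C → x = p ∧ y = v) (hf : f ∉ C) (hHK : H ≤ K)
    {n : ℕ} {y : V} {S : Set V} (h : AltFrom H M f n y S) :
    y ∈ C → ∀ q z R, AltFrom K M f q z R → (∀ w ∈ R, w ∈ C → w ∉ S) → K.Adj z y →
      (s(z, y) ∈ M ↔ q % 2 = 1) → q % 2 = n % 2 →
      ∃ m, (s(p, v) ∈ M ↔ m % 2 = 1) ∧ ReachLen K M f m v := by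
  induction h with
  | nil => exact fun h => absurd h hf
  | @snoc n x y S h hadj hy hp ih =>
    intro hyC q z R hQ hdis hzy hzyM hpar
    have hyR : y ∉ R := fun hm => hdis y hm hyC (Set.mem_insert _ _)
    have hQ' := hQ.snoc hzy hyR hzyM
    by_cases hx : x ∈ C
    · refine ih hx (q + 1) y _ hQ' ?_ (hHK hadj.symm) ?_ (by omega)
      · rintro w (rfl | hw) hwC
        · exact hy
        · exact fun hm => hdis w hw hwC (.inr hm)
      · rw [Sym2.eq_swap, hp]
        omega
    · obtain ⟨rfl, rfl⟩ := hC x y hadj hx hyC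
      refine ⟨q + 1, ?_, _, hQ'⟩
      rw [hp]
      omega

/-- Follow an alternating path backwards from its end in `C` to the last edge entering `C`,
extending on the way an alternating path `R` that ends in the same vertex. -/
lemma AltFrom.reverse_to_crossing {C : Set V} (hf : f ∉ C)
    {n : ℕ} {y : V} {S : Set V} (h : AltFrom H M f n y S) :
    y ∈ C → ∀ q R, AltFrom H M f q y R → (∀ w ∈ R, w ∈ C → w ∈ S → w = y) →
      q % 2 ≠ n % 2 →
      ∃ x y' a b, x ∉ C ∧ y' ∈ C ∧ H.Adj x y' ∧ ReachLen H M f a x ∧ ReachLen H M f b y' ∧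
        ReachLen H M f (a + 1) y' ∧
        (s(x, y') ∈ M ↔ a % 2 = 1) ∧ a % 2 = b % 2 ∧ a + b + 1 = n + q ∧ a + 1 ≤ n ∧
        y' ∈ S ∧ (y' = y → a + 1 = n) := by
  induction h with
  | nil => exact fun h => absurd h hf
  | @snoc n x y S h hadj hy hp ih =>
    intro hyC q R hQ hdis hpar
    by_cases hx : x ∈ C
    · have hxy : x ≠ y := hadj.ne
      have hxR : x ∉ R := fun hm => hxy (hdis x hm hx (.inr h.end_mem))
      have hQ' := hQ.snoc hadj.symm hxR (by rw [Sym2.eq_swap, hp]; omega)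
      obtain ⟨x', y', a, b, h1, h2, h3, h4, h5, h6, h7, h8, h9, h10, h11, -⟩ :=
        ih hx (q + 1) _ hQ' (by
          rintro w (rfl | hw) hwC hwS
          · rfl
          · have := hdis w hw hwC (.inr hwS)
            exact absurd (this ▸ hwS) hy) (by omega)
      refine ⟨x', y', a, b, h1, h2, h3, h4, h5, h6, h7, h8, by omega, by omega, .inr h11, ?_⟩
      rintro rfl
      exact absurd h11 hy
    · exact ⟨x, y, n, q, hx, hyC, hadj, ⟨S, h⟩, ⟨R, hQ⟩, ⟨_, h.snoc hadj hy hp⟩, hp, by omega,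
        by omega, le_rfl, .inl rfl, fun _ => rfl⟩

end AltFrom

/-- The edge `s(x, y)` of `G` has level at most `k`. -/
def LevelAtMost {V : Type*} (G : SimpleGraph V) (M : Set (Sym2 V)) (f : V) (k : ℕ) (x y : V) :
    Prop :=
  G.Adj x y ∧ ∃ a b, a ≤ k ∧ b ≤ k ∧ ReachLen G M f a x ∧ ReachLen G M f b y ∧
    a % 2 = b % 2 ∧ (s(x, y) ∈ M ↔ a % 2 = 1)

/-- The combinatorial content of an alternating base tree: `R v` is the length of a shortest
alternating path to `v`, and `C v` is the vertex set of the subtree at `v`. -/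
structure SubtreeData {V : Type*} (G : SimpleGraph V) (M : Set (Sym2 V)) (f : V)
    (T : SimpleGraph V) (par : V → V) (R : V → ℕ) (C : V → Set V) : Prop where
  reach : ∀ v, ReachLen G M f (R v) v
  le_len : ∀ v n, ReachLen G M f n v → R v ≤ n
  reach_par : ∀ v, v ≠ f → ∃ n, n + 1 = R v ∧ ReachLen G M f n (par v)
  par_adj : ∀ v, v ≠ f → T.Adj (par v) v
  par_mem : ∀ v, v ≠ f → (s(par v, v) ∈ M ↔ R v % 2 = 0)
  self_mem : ∀ v, v ∈ C v
  root_notMem : ∀ v, v ≠ f → f ∉ C v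
  par_notMem : ∀ v, v ≠ f → par v ∉ C v
  tree_cross : ∀ v, v ≠ f → ∀ x y, T.Adj x y → x ∉ C v → y ∈ C v → x = par v ∧ y = v
  lt_of_mem : ∀ v, v ≠ f → ∀ x ∈ C v, x ≠ v → R v < R x

/-- Some non-tree edge of level at most `i` enters the subtree `C v`. -/
def Crossed {V : Type*} (G : SimpleGraph V) (M : Set (Sym2 V)) (f : V) (T : SimpleGraph V)
    (C : V → Set V) (i : ℕ) (v : V) : Prop :=
  ∃ x y, x ∉ C v ∧ y ∈ C v ∧ ¬ T.Adj x y ∧ LevelAtMost G M f i x y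

/-- A monotone sequence of subgraphs `H 0 ≤ H 1 ≤ ⋯`, consisting of tree edges and edges of small
level, in which every subtree is entered as soon as it is in `G`. -/
structure Cover {V : Type*} (G : SimpleGraph V) (M : Set (Sym2 V)) (f : V)
    (T : SimpleGraph V) (C : V → Set V) (k : ℕ) (H : ℕ → SimpleGraph V) : Prop where
  tree_le : ∀ i, T ≤ H i
  mono : ∀ i j, i ≤ j → H i ≤ H j
  level : ∀ i ≤ k, ∀ x y, (H i).Adj x y → T.Adj x y ∨ LevelAtMost G M f i x y
  cross : ∀ i ≤ k, 1 ≤ i → ∀ v, v ≠ f → Crossed G M f T C i v → ¬ Crossed G M f T C (i - 1) v →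
    ∃ x y, x ∉ C v ∧ y ∈ C v ∧ (H i).Adj x y ∧ LevelAtMost G M f i x y

section Main

variable {V : Type*} {G : SimpleGraph V} {M : Set (Sym2 V)} {f : V} {T : SimpleGraph V}
  {par : V → V} {R : V → ℕ} {C : V → Set V} {k : ℕ} {H : ℕ → SimpleGraph V}

lemma LevelAtMost.mono {i j : ℕ} (hij : i ≤ j) {x y : V} (h : LevelAtMost G M f i x y) :
    LevelAtMost G M f j x y := by
  obtain ⟨h0, a, b, ha, hb, h⟩ := h
  exact ⟨h0, a, b, ha.trans hij, hb.trans hij, h⟩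

lemma LevelAtMost.symm {i : ℕ} {x y : V} (h : LevelAtMost G M f i x y) :
    LevelAtMost G M f i y x := by
  obtain ⟨h0, a, b, ha, hb, hx, hy, hab, hm⟩ := h
  refine ⟨h0.symm, b, a, hb, ha, hy, hx, hab.symm, ?_⟩
  rw [Sym2.eq_swap, hm, hab]

lemma not_levelAtMost_zero {x y : V} : ¬ LevelAtMost G M f 0 x y := by
  rintro ⟨h0, a, b, ha, hb, hx, hy, -⟩
  obtain rfl : a = 0 := by omega
  obtain rfl : b = 0 := by omega
  exact h0.ne (hx.eq_root.trans hy.eq_root.symm)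

lemma SubtreeData.le_of_crossed (D : SubtreeData G M f T par R C) {i : ℕ} {v : V} (hv : v ≠ f)
    (h : Crossed G M f T C i v) : R v ≤ i := by
  obtain ⟨x, y, -, hy, -, -, a, b, -, hb, -, hry, -⟩ := h
  have h1 := D.le_len y b hry
  by_cases hyv : y = v
  · subst hyv; omega
  · have := D.lt_of_mem v hv y hy hyv
    omega

lemma SubtreeData.one_le (D : SubtreeData G M f T par R C) {v : V} (hv : v ≠ f) : 1 ≤ R v := by
  obtain ⟨n, hn, -⟩ := D.reach_par v hv
  omega

/-- Without crossing non-tree edges, the parent edge is the only edge entering a subtree. -/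
lemma SubtreeData.only_cross (D : SubtreeData G M f T par R C) {K : SimpleGraph V} {i : ℕ}
    (hK : ∀ x y, K.Adj x y → T.Adj x y ∨ LevelAtMost G M f i x y) {v : V} (hv : v ≠ f)
    (hnc : ¬ Crossed G M f T C i v) :
    ∀ x y, K.Adj x y → x ∉ C v → y ∈ C v → x = par v ∧ y = v := by
  intro x y hadj hx hy
  by_cases hT : T.Adj x y
  · exact D.tree_cross v hv x y hT hx hy
  · exact absurd ⟨x, y, hx, hy, hT, (hK x y hadj).resolve_left hT⟩ hnc

/-- A vertex reached with the parity opposite to that of `R v` by a path of length `n` has a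
subtree entered by a non-tree edge of level less than `n`. -/
lemma SubtreeData.crossed_of_reach (D : SubtreeData G M f T par R C) {v : V} (hv : v ≠ f) {n : ℕ}
    (h : ReachLen G M f n v) (hn : n % 2 ≠ R v % 2) : Crossed G M f T C (n - 1) v := by
  obtain ⟨S, hS⟩ := h
  obtain ⟨Q, hQ⟩ := D.reach v
  have hlt : R v < n := lt_of_le_of_ne (D.le_len v n ⟨S, hS⟩) (fun h => hn (by rw [h]))
  have hQC : ∀ w ∈ Q, w ∈ C v → w ∈ S → w = v := by
    intro w hw hwC _
    by_contra hne
    obtain ⟨m, hm, hr⟩ := (hQ.exists_prefix w hw).resolve_left hne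
    have h1 := D.le_len w m hr
    have h2 := D.lt_of_mem v hv w hwC hne
    omega
  obtain ⟨x, y, a, b, hx, hy, hadj, hax, hby, hay, hm, hab, hsum, han, -, hyv⟩ :=
    hS.reverse_to_crossing (D.root_notMem v hv) (D.self_mem v) (R v) Q hQ hQC (Ne.symm hn)
  have hRa : R v ≤ a := by
    by_cases hyv' : y = v
    · have := hyv hyv'
      omega
    · have h1 := D.lt_of_mem v hv y hy hyv'
      have h2 := D.le_len y _ hay
      omega
  refine ⟨x, y, hx, hy, ?_, hadj, a, b, by omega, by omega, hax, hby, hab, hm⟩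
  intro hT
  obtain ⟨rfl, rfl⟩ := D.tree_cross v hv x y hT hx hy
  have h1 := hyv rfl
  have h2 := D.par_mem y hv
  rw [hm] at h2
  omega

/-- At the first level at which the subtree of `v` is entered, `v` becomes reachable with the
parity opposite to that of `R v`. -/
lemma SubtreeData.reach_of_cross (D : SubtreeData G M f T par R C) (hH : Cover G M f T C k H)
    {i : ℕ} (hik : i ≤ k) (hi : 1 ≤ i)
    (ih : ∀ n ≤ i, ∀ u, ReachLen G M f n u → ReachPar (H (i - 1)) M f n u)
    {v : V} (hv : v ≠ f) (hc : Crossed G M f T C i v) (hnc : ¬ Crossed G M f T C (i - 1) v) :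
    ReachPar (H i) M f (R v + 1) v := by
  obtain ⟨x, y, hx, hy, hadj, -, a, b, ha, hb, hrx, hry, hab, hm⟩ := hH.cross i hik hi v hv hc hnc
  obtain ⟨a', ha', P, hP⟩ := ih a ha x hrx
  obtain ⟨b', hb', Q, hQ⟩ := ih b hb y hry
  have hC := D.only_cross (hH.level (i - 1) (by omega)) hv hnc
  have hf := D.root_notMem v hv
  have hle := hH.mono (i - 1) i (by omega)
  obtain ⟨m, hpm, hr⟩ := hQ.reverse_glue hC hf hle hy a' x P (hP.mono hle)
    (fun w hw hwC => absurd hwC ((hP.avoid hC hf).1 hx w hw)) hadj (by rw [hm, ha']) (by omega)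
  refine ⟨m, ?_, hr⟩
  have := D.par_mem v hv
  rw [hpm] at this
  omega

lemma Crossed.exists_first {i : ℕ} {v : V} (h : Crossed G M f T C i v) :
    ∃ j, 1 ≤ j ∧ j ≤ i ∧ Crossed G M f T C j v ∧ ¬ Crossed G M f T C (j - 1) v := by
  classical
  have hex : ∃ j, Crossed G M f T C j v := ⟨i, h⟩
  have h1 : 1 ≤ Nat.find hex := by
    rw [Nat.one_le_iff_ne_zero]
    intro h0
    have := Nat.find_spec hex
    rw [h0] at this
    obtain ⟨x, y, -, -, -, hl⟩ := this
    exact not_levelAtMost_zero hl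
  exact ⟨Nat.find hex, h1, Nat.find_min' hex h, Nat.find_spec hex,
    Nat.find_min hex (by omega)⟩

/-- A path to the parent avoiding the subtree of `v` extends to `v`. -/
lemma SubtreeData.reach_of_par (D : SubtreeData G M f T par R C) {K : SimpleGraph V} (hTK : T ≤ K)
    {v : V} (hv : v ≠ f) (hC : ∀ x y, K.Adj x y → x ∉ C v → y ∈ C v → x = par v ∧ y = v)
    {n : ℕ} (h : ReachPar K M f n (par v)) (hn : (n + 1) % 2 = R v % 2) :
    ReachPar K M f (n + 1) v := by
  obtain ⟨m, hm, P, hP⟩ := h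
  have hav := (hP.avoid hC (D.root_notMem v hv)).1 (D.par_notMem v hv)
  refine ⟨m + 1, by omega, _, hP.snoc (hTK (D.par_adj v hv))
    (fun h => hav v h (D.self_mem v)) ?_⟩
  rw [D.par_mem v hv]
  omega

/-- A vertex reached in `G` by a path of length `n` is reached in `H (n - 1)` with the same
parity. -/
lemma SubtreeData.reach_pred (D : SubtreeData G M f T par R C) (hH : Cover G M f T C k H) (n : ℕ) :
    n ≤ k + 1 → ∀ u, ReachLen G M f n u → ReachPar (H (n - 1)) M f n u := by
  induction n using Nat.strong_induction_on with
  | _ n ih =>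
    intro hn u hu
    by_cases huf : u = f
    · subst huf
      rw [hu.eq_zero]
      exact ⟨0, rfl, _, .nil⟩
    have hRn := D.le_len u n hu
    have hR1 := D.one_le huf
    by_cases hpar : n % 2 = R u % 2
    · obtain ⟨m, hm, hr⟩ := D.reach_par u huf
      have h1 := (ih m (by omega) (by omega) (par u) hr)
      have hnc : ¬ Crossed G M f T C (m - 1) u := fun hc => by
        have := D.le_of_crossed huf hc
        omega
      have hC := D.only_cross (hH.level (m - 1) (by omega)) huf hnc
      exact ((D.reach_of_par (hH.tree_le _) huf hC h1 (by omega)).mono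
        (hH.mono _ _ (by omega))).congr (by omega)
    · obtain ⟨j, hj1, hjn, hc, hnc⟩ := (D.crossed_of_reach huf hu hpar).exists_first
      refine ((D.reach_of_cross hH (by omega) hj1 ?_ huf hc hnc).mono
        (hH.mono _ _ hjn)).congr (by omega)
      intro l hl w hw
      exact (ih l (by omega) (by omega) w hw).mono (hH.mono _ _ (by omega))

/-- The subgraph `H k` of a cover preserves the reachability of every subgraph consisting of tree
edges and edges of level at most `k`. -/
theorem SubtreeData.reach_preserved (D : SubtreeData G M f T par R C) (hH : Cover G M f T C k H)
    {K : SimpleGraph V} (hK : ∀ x y, K.Adj x y → T.Adj x y ∨ LevelAtMost G M f k x y)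
    {n : ℕ} {v : V} {S : Set V} (h : AltFrom K M f n v S) :
    ReachPar (H k) M f n v := by
  induction h with
  | nil => exact ⟨0, rfl, _, .nil⟩
  | @snoc n w v S h hadj hvS hp ih =>
    have hvf : v ≠ f := fun hvf => hvS (hvf ▸ h.root_mem)
    by_cases hc : Crossed G M f T C k v
    · by_cases hpar : (n + 1) % 2 = R v % 2
      · have hRk := D.le_of_crossed hvf hc
        exact ((D.reach_pred hH (R v) (by omega) v (D.reach v)).mono
          (hH.mono _ _ (by omega))).congr hpar.symm
      · obtain ⟨j, hj1, hjk, hc, hnc⟩ := hc.exists_first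
        refine ((D.reach_of_cross hH hjk hj1 ?_ hvf hc hnc).mono
          (hH.mono _ _ hjk)).congr (by omega)
        intro l hl u hu
        exact (D.reach_pred hH l (by omega) u hu).mono (hH.mono _ _ (by omega))
    · have hCK := D.only_cross hK hvf hc
      have hCH := D.only_cross (hH.level k le_rfl) hvf hc
      have hw : w ∉ C v := fun hw => hvS ((h.avoid hCK (D.root_notMem v hvf)).2 hw).2
      obtain ⟨rfl, -⟩ := hCK w v hadj hw (D.self_mem v)
      refine D.reach_of_par (hH.tree_le k) hvf hCH ih ?_
      have := D.par_mem v hvf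
      rw [hp] at this
      omega

end Main

section Walks

variable {V : Type*} {H : SimpleGraph V} {M : Set (Sym2 V)} {f : V}

lemma AltFrom.exists_walk {n : ℕ} {x : V} {S : Set V} (h : AltFrom H M f n x S) :
    ∃ p : H.Walk f x, p.IsPath ∧ (∀ w ∈ p.support, w ∈ S) ∧ p.length = n ∧
      ∀ (i : ℕ) (hi : i < p.edges.length), p.edges[i] ∈ M ↔ i % 2 = 1 := by
  induction h with
  | nil => exact ⟨.nil, .nil, by simp, rfl, fun i hi => by simp at hi⟩
  | @snoc n x y S h hadj hy hp ih =>
    obtain ⟨p, hpath, hsup, hlen, halt⟩ := ih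
    refine ⟨p.concat hadj, hpath.concat (fun h => hy (hsup y h)) hadj, ?_, by simp [hlen], ?_⟩
    · intro w hw
      rw [Walk.support_concat, List.mem_append, List.mem_singleton] at hw
      exact hw.elim (fun h => .inr (hsup w h)) (fun h => .inl h)
    · intro i hi
      simp only [Walk.edges_concat, List.concat_eq_append]
      rw [List.getElem_append]
      split_ifs with hlt
      · exact halt i hlt
      · simp only [Walk.edges_concat, List.concat_eq_append, List.length_append,
          List.length_singleton, Walk.length_edges] at hi hlt
        obtain rfl : i = n := by omega
        simpa using hp

lemma AltFrom.append_walk {u v : V} (p : H.Walk u v) :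
    ∀ (n : ℕ) (S : Set V), AltFrom H M f n u S → p.IsPath → (∀ w ∈ p.support, w ∈ S → w = u) →
      (∀ (i : ℕ) (hi : i < p.edges.length), p.edges[i] ∈ M ↔ (n + i) % 2 = 1) →
      ReachLen H M f (n + p.length) v := by
  induction p with
  | nil => exact fun n S h _ _ _ => ⟨S, h⟩
  | @cons u w v hadj p ih =>
    intro n S h hp hsup halt
    rw [Walk.cons_isPath_iff] at hp
    have hw : w ∉ S := fun hw => hadj.ne' (hsup w (by simp) hw)
    have h0 := halt 0 (by simp)
    simp only [Walk.edges_cons, List.getElem_cons_zero, Nat.add_zero] at h0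
    have := ih (n + 1) _ (h.snoc hadj hw h0) hp.1 ?_ ?_
    · rwa [Walk.length_cons, show n + (p.length + 1) = n + 1 + p.length by omega]
    · rintro z hz (rfl | hzS)
      · rfl
      · have := hsup z (by simp [hz]) hzS
        exact absurd (this ▸ hz) hp.2
    · intro i hi
      have := halt (i + 1) (by simpa using hi)
      simp only [Walk.edges_cons, List.getElem_cons_succ] at this
      rw [this, show n + (i + 1) = n + 1 + i by omega]

/-- Along an alternating list starting outside `M`, membership in `M` is determined by the
position. -/
lemma AltList.getElem_mem_iff {l : List (Sym2 V)} (h : AltList M l)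
    (h0 : ∀ hl : 0 < l.length, l[0] ∉ M) :
    ∀ (i : ℕ) (hi : i < l.length), l[i] ∈ M ↔ i % 2 = 1 := by
  intro i
  induction i with
  | zero => exact fun hi => by simpa using h0 hi
  | succ i ih =>
    intro hi
    have h1 := h i hi
    have h2 := ih (by omega)
    simp only [List.get_eq_getElem] at h1
    rw [h2] at h1
    constructor
    · intro hm
      by_contra hne
      exact h1.1 (by omega) hm
    · intro hm
      by_contra hne
      have := h1.2 hne
      omega

/-- Paths built edge by edge are exactly alternating walks, when starting from an unmatched
node. -/
lemma reachLen_iff (hf : ¬ Matched M f) {n : ℕ} {v : V} :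
    ReachLen H M f n v ↔ ∃ p : H.Walk f v, IsAltPath M p ∧ p.length = n := by
  constructor
  · rintro ⟨S, hS⟩
    obtain ⟨p, hp, -, hlen, halt⟩ := hS.exists_walk
    refine ⟨p, ⟨hp, fun i hi => ?_⟩, hlen⟩
    simp only [List.get_eq_getElem]
    rw [halt i (by omega), halt (i + 1) hi]
    omega
  · rintro ⟨p, ⟨hp, halt⟩, rfl⟩
    have h0 : ∀ hl : 0 < p.edges.length, p.edges[0] ∉ M := by
      intro hl hm
      cases p with
      | nil => simp at hl
      | cons h p => exact hf ⟨_, hm, by simp⟩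
    have := AltFrom.append_walk p 0 {f} .nil hp (fun w _ hw => hw)
      (fun i hi => by rw [Nat.zero_add]; exact halt.getElem_mem_iff h0 i hi)
    rwa [Nat.zero_add] at this

lemma thetaReach_iff (hf : ¬ Matched M f) {θ : ℕ} {v : V} :
    ThetaReach H M θ f v ↔ ∃ n, n % 2 = θ ∧ ReachLen H M f n v := by
  constructor
  · rintro ⟨p, hp, hθ⟩
    exact ⟨p.length, hθ, (reachLen_iff hf).2 ⟨p, hp, rfl⟩⟩
  · rintro ⟨n, hθ, h⟩
    obtain ⟨p, hp, rfl⟩ := (reachLen_iff hf).1 h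
    exact ⟨p, hp, hθ⟩

lemma rAlt_le_s7 (hf : ¬ Matched M f) {θ n : ℕ} {v : V} (h : ReachLen H M f n v) (hn : n % 2 = θ) :
    rAlt H M θ f v ≤ n := by
  obtain ⟨p, hp, rfl⟩ := (reachLen_iff hf).1 h
  exact sInf_le ⟨p, hp, hn, rfl⟩

lemma reachLen_of_rAlt_eq (hf : ¬ Matched M f) {θ n : ℕ} {v : V} (h : rAlt H M θ f v = n) :
    n % 2 = θ ∧ ReachLen H M f n v := by
  have hne : {n : ℕ∞ | ∃ p : H.Walk f v, IsAltPath M p ∧ p.length % 2 = θ ∧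
      (p.length : ℕ∞) = n}.Nonempty := by
    rw [Set.nonempty_iff_ne_empty]
    intro he
    rw [rAlt, he, sInf_empty] at h
    exact ENat.top_ne_natCast n h
  obtain ⟨p, hp, hθ, hlen⟩ := csInf_mem hne
  have h' : (p.length : ℕ∞) = n := hlen.trans h
  have h'' : p.length = n := by exact_mod_cast h'
  exact ⟨h'' ▸ hθ, (reachLen_iff hf).2 ⟨p, hp, h''⟩⟩

lemma exists_rAlt_eq_of_le {θ k : ℕ} {v : V} (h : rAlt H M θ f v ≤ k) :
    ∃ n ≤ k, rAlt H M θ f v = n := by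
  obtain ⟨n, hn⟩ := ENat.ne_top_iff_exists.1 (ne_top_of_le_ne_top (ENat.natCast_ne_top k) h)
  rw [← hn] at h ⊢
  exact ⟨n, by exact_mod_cast h, rfl⟩

/-- The parity `gam` is that of the length of a shortest alternating path. -/
lemma gam_eq_of_shortest (hf : ¬ Matched M f) {n : ℕ} {v : V} (h : ReachLen H M f n v)
    (hmin : ∀ m, ReachLen H M f m v → n ≤ m) :
    gam H M f v = n % 2 ∧ rAlt H M (n % 2) f v = n := by
  have hle := rAlt_le_s7 hf h rfl
  have heq : rAlt H M (n % 2) f v = n := by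
    obtain ⟨m, hm, hr⟩ := exists_rAlt_eq_of_le hle
    have := hmin m (reachLen_of_rAlt_eq hf hr).2
    rw [hr]
    exact_mod_cast le_antisymm hm this
  refine ⟨?_, heq⟩
  have hother : ∀ θ, θ ≠ n % 2 → ¬ rAlt H M θ f v ≤ n := by
    intro θ hθ hl
    obtain ⟨m, hm, hr⟩ := exists_rAlt_eq_of_le hl
    obtain ⟨h1, h2⟩ := reachLen_of_rAlt_eq hf hr
    have := hmin m h2
    exact hθ (by rw [← h1, le_antisymm hm this])
  unfold gam
  rcases Nat.mod_two_eq_zero_or_one n with h0 | h0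
  · rw [if_pos, h0]
    rw [h0] at heq
    rw [heq]
    exact le_of_lt (not_le.1 (hother 1 (by omega)))
  · rw [if_neg, h0]
    rw [h0] at heq
    rw [heq]
    exact hother 0 (by omega)

lemma levelAtMost_of_mem_levelLe {G : SimpleGraph V} (hf : ¬ Matched M f) {k : ℕ} {x y : V}
    (h : s(x, y) ∈ levelLe G M f k) : LevelAtMost G M f k x y := by
  obtain ⟨i, -, hik, hadj, u, w, he, hl⟩ := h
  have key : LevelAtMost G M f k u w := by
    rw [he, mem_edgeSet] at hadj
    refine ⟨hadj, ?_⟩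
    have aux : ∀ θ, max (rAlt G M θ f u) (rAlt G M θ f w) = (i : ℕ∞) →
        ∃ a b, a ≤ k ∧ b ≤ k ∧ ReachLen G M f a u ∧ ReachLen G M f b w ∧ a % 2 = θ ∧
          b % 2 = θ := by
      intro θ hmax
      obtain ⟨a, ha, hra⟩ := exists_rAlt_eq_of_le ((le_max_left _ _).trans hmax.le)
      obtain ⟨b, hb, hrb⟩ := exists_rAlt_eq_of_le ((le_max_right _ _).trans hmax.le)
      obtain ⟨ha1, ha2⟩ := reachLen_of_rAlt_eq hf hra
      obtain ⟨hb1, hb2⟩ := reachLen_of_rAlt_eq hf hrb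
      exact ⟨a, b, ha.trans hik, hb.trans hik, ha2, hb2, ha1, hb1⟩
    rw [← he]
    rcases hl with ⟨hm, hmax⟩ | ⟨hm, hmax⟩
    · obtain ⟨a, b, ha, hb, hra, hrb, h1, h2⟩ := aux 0 hmax
      exact ⟨a, b, ha, hb, hra, hrb, h1.trans h2.symm, by simp [hm, h1]⟩
    · obtain ⟨a, b, ha, hb, hra, hrb, h1, h2⟩ := aux 1 hmax
      exact ⟨a, b, ha, hb, hra, hrb, h1.trans h2.symm, by simp [hm, h1]⟩
  rcases Sym2.eq_iff.1 he with ⟨rfl, rfl⟩ | ⟨rfl, rfl⟩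
  · exact key
  · exact key.symm

lemma LevelAtMost.mem_levelLe {G : SimpleGraph V} (hf : ¬ Matched M f) {k : ℕ} {x y : V}
    (h : LevelAtMost G M f k x y) : s(x, y) ∈ levelLe G M f k := by
  obtain ⟨hadj, a, b, ha, hb, hra, hrb, hab, hm⟩ := h
  have hle : max (rAlt G M (a % 2) f x) (rAlt G M (a % 2) f y) ≤ (k : ℕ∞) :=
    max_le ((rAlt_le_s7 hf hra rfl).trans (by exact_mod_cast ha))
      ((rAlt_le_s7 hf hrb hab.symm).trans (by exact_mod_cast hb))
  obtain ⟨i, hi⟩ := ENat.ne_top_iff_exists.1 (ne_top_of_le_ne_top (ENat.natCast_ne_top k) hle)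
  have hmem : s(x, y) ∈ levelSet G M f i := by
    refine ⟨hadj, x, y, rfl, ?_⟩
    rcases Nat.mod_two_eq_zero_or_one a with h0 | h0
    · rw [h0] at hi hm
      exact Or.inl ⟨by simp [hm], hi.symm⟩
    · rw [h0] at hi hm
      exact Or.inr ⟨by simp [hm], hi.symm⟩
  refine ⟨i, ?_, ?_, hmem⟩
  · rw [Nat.one_le_iff_ne_zero]
    rintro rfl
    have hx := (le_max_left _ _).trans hi.symm.le
    have hy := (le_max_right _ _).trans hi.symm.le
    obtain ⟨a', ha', hx'⟩ := exists_rAlt_eq_of_le hx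
    obtain ⟨b', hb', hy'⟩ := exists_rAlt_eq_of_le hy
    obtain rfl : a' = 0 := by omega
    obtain rfl : b' = 0 := by omega
    exact hadj.ne ((reachLen_of_rAlt_eq hf hx').2.eq_root.trans
      (reachLen_of_rAlt_eq hf hy').2.eq_root.symm)
  · rw [← hi] at hle
    exact_mod_cast hle

end Walks

/-- The component of `v` in the tree `T` after deleting the edge between `v` and its parent. -/
def subtree {V : Type*} (T : SimpleGraph V) (par : V → V) (v : V) : Set V :=
  {x | (T.deleteEdges {s(v, par v)}).Reachable v x}

section Subtree

variable {V : Type*} {G T : SimpleGraph V} {M : Set (Sym2 V)} {f : V} {par : V → V}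

lemma mem_subtree_of_adj {v x y : V} (h : T.Adj x y) (hne : s(x, y) ≠ s(v, par v))
    (hx : x ∈ subtree T par v) : y ∈ subtree T par v :=
  Reachable.trans hx (Adj.reachable (deleteEdges_adj.2 ⟨h, hne⟩))

lemma reachable_par_of_notMem_subtree (hT : T.Connected) {v x : V}
    (hx : x ∉ subtree T par v) : (T.deleteEdges {s(v, par v)}).Reachable (par v) x := by
  have hall : ∀ z, Relation.ReflTransGen T.Adj (par v) z →
      z ∈ subtree T par v ∨ (T.deleteEdges {s(v, par v)}).Reachable (par v) z := by
    intro z hz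
    induction hz with
    | refl => exact Or.inr (Reachable.refl _)
    | @tail a b _ hab ih =>
      by_cases he : s(a, b) = s(v, par v)
      · rcases Sym2.eq_iff.1 he with ⟨rfl, rfl⟩ | ⟨rfl, rfl⟩
        · exact Or.inr (Reachable.refl _)
        · exact Or.inl (Reachable.refl _)
      · exact ih.imp (mem_subtree_of_adj hab he)
          (fun h => h.trans (Adj.reachable (deleteEdges_adj.2 ⟨hab, he⟩)))
  exact (hall x ((reachable_iff_reflTransGen _ _).1 (hT.preconnected _ _))).resolve_left hx

/-- In an acyclic graph, a path through `e` joins vertices that are separated by deleting `e`. -/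
lemma notMem_edges_of_reachable (hT : T.IsAcyclic) {e : Sym2 V} {u w : V} {p : T.Walk u w}
    (hp : p.IsPath) (h : (T.deleteEdges {e}).Reachable u w) : e ∉ p.edges := by
  obtain ⟨q, hq⟩ := h.exists_isPath
  have heq := (hT.subsingleton_path u w).elim ⟨p, hp⟩ ⟨q.mapLe (deleteEdges_le _), hq.mapLe _⟩
  have heq' : p = q.mapLe (deleteEdges_le _) := congrArg Subtype.val heq
  rw [heq', Walk.edges_mapLe_eq_edges]
  intro he
  have := q.edges_subset_edgeSet he
  simp at this

/-- The shortest path lengths and the subtrees of an alternating base tree. -/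
lemma AltBaseTree.subtreeData (hf : ¬ Matched M f) (habt : AltBaseTree G M f T par)
    {R : V → ℕ} (hR : ∀ v, ReachLen G M f (R v) v)
    (hmin : ∀ v n, ReachLen G M f n v → R v ≤ n) :
    SubtreeData G M f T par R (subtree T par) := by
  have hpar : ∀ v, v ≠ f → ∃ n, n + 1 = R v ∧ ReachLen G M f n (par v) := by
    intro v hv
    obtain ⟨hg, hr⟩ := gam_eq_of_shortest hf (hR v) (hmin v)
    have h1 := habt.r_eq v hv
    rw [hg, hr] at h1
    have h2 : rAlt G M (1 - R v % 2) f (par v) ≤ (R v : ℕ∞) := by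
      rw [h1]
      exact le_self_add
    obtain ⟨n, -, hn⟩ := exists_rAlt_eq_of_le h2
    refine ⟨n, ?_, (reachLen_of_rAlt_eq hf hn).2⟩
    rw [hn] at h1
    exact_mod_cast h1.symm
  have hpn : ∀ v, v ≠ f → par v ∉ subtree T par v := fun v hv =>
    (isAcyclic_iff_forall_adj_isBridge.1 habt.tree.isAcyclic) (habt.adj v hv)
  have hne : ∀ v, v ≠ f → ∀ x, x ≠ f → x ≠ v → s(x, par x) ≠ s(v, par v) := by
    intro v hv x hx hxv he
    rcases Sym2.eq_iff.1 he with ⟨h1, -⟩ | ⟨h1, h2⟩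
    · exact hxv h1
    · have e1 := habt.parent_dist v hv
      have e2 := habt.parent_dist x hx
      rw [← h1] at e1
      rw [h2] at e2
      omega
  have hroot : ∀ v, v ≠ f → f ∉ subtree T par v := by
    intro v hv
    have hall : ∀ n x, T.dist f x = n → n < T.dist f v → x ∉ subtree T par v →
        f ∉ subtree T par v := by
      intro n
      induction n with
      | zero =>
        intro x hx _ hxs
        rwa [(habt.tree.connected.dist_eq_zero_iff).1 hx]
      | succ n ih =>
        intro x hx hlt hxs
        have hxf : x ≠ f := by
          rintro rfl
          simp at hx
        have hxv : x ≠ v := by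
          rintro rfl
          omega
        have hd := habt.parent_dist x hxf
        refine ih (par x) (by omega) (by omega) (fun hp => hxs ?_)
        refine mem_subtree_of_adj (habt.adj x hxf).symm ?_ hp
        rw [Sym2.eq_swap]
        exact hne v hv x hxf hxv
    have hd := habt.parent_dist v hv
    exact hall _ (par v) rfl (by omega) (hpn v hv)
  refine ⟨hR, hmin, hpar, fun v hv => (habt.adj v hv).symm, ?_, fun v => Reachable.refl _, hroot,
    hpn, ?_, ?_⟩
  · intro v hv
    rw [Sym2.eq_swap, habt.edge_mem v hv, (gam_eq_of_shortest hf (hR v) (hmin v)).1]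
  · intro v hv x y hadj hx hy
    by_cases he : s(y, x) = s(v, par v)
    · rcases Sym2.eq_iff.1 he with ⟨h1, h2⟩ | ⟨h1, -⟩
      · exact ⟨h2, h1⟩
      · exact absurd (h1 ▸ hy) (hpn v hv)
    · exact absurd (mem_subtree_of_adj hadj.symm he hy) hx
  · intro v hv
    have hall : ∀ n x, T.dist f x = n → x ∈ subtree T par v → x ≠ v → R v < R x := by
      intro n
      induction n with
      | zero =>
        intro x hx hxs _
        rw [← (habt.tree.connected.dist_eq_zero_iff).1 hx] at hxs
        exact absurd hxs (hroot v hv)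
      | succ n ih =>
        intro x hx hxs hxv
        have hxf : x ≠ f := by
          rintro rfl
          simp at hx
        have hd := habt.parent_dist x hxf
        have hps := mem_subtree_of_adj (habt.adj x hxf) (hne v hv x hxf hxv) hxs
        obtain ⟨m, hm, hr⟩ := hpar x hxf
        have h1 := hmin _ _ hr
        by_cases hpv : par x = v
        · rw [hpv] at h1
          omega
        · have := ih (par x) (by omega) hps hpv
          omega
    exact fun x hx hxv => hall _ x rfl hx hxv

lemma graphAt_adj (hf : ¬ Matched M f) {k : ℕ} {x y : V} (h : (graphAt T G M f k).Adj x y) :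
    T.Adj x y ∨ LevelAtMost G M f k x y := by
  obtain ⟨h | h, -⟩ := (fromEdgeSet_adj _).1 h
  · exact Or.inl h
  · exact Or.inr (levelAtMost_of_mem_levelLe hf h)

/-- The parent edge of `v` stops being a bridge exactly when its subtree gets entered by a
non-tree edge. -/
lemma SubtreeData.mem_Bset_iff (hf : ¬ Matched M f) (hT : T.Connected) {R : V → ℕ}
    (D : SubtreeData G M f T par R (subtree T par)) {i : ℕ} {v : V} (hv : v ≠ f) :
    s(v, par v) ∈ Bset T G M f i ↔ ¬ Crossed G M f T (subtree T par) i v := by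
  change ¬ ((graphAt T G M f i).deleteEdges {s(v, par v)}).Reachable v (par v) ↔ _
  rw [not_iff_not]
  constructor
  · intro h
    by_contra hnc
    have hC := D.only_cross (fun _ _ => graphAt_adj hf) hv hnc
    have hall : ∀ z, Relation.ReflTransGen
        ((graphAt T G M f i).deleteEdges {s(v, par v)}).Adj v z → z ∈ subtree T par v := by
      intro z hz
      induction hz with
      | refl => exact D.self_mem v
      | @tail a b _ hab ih =>
        by_contra hb
        obtain ⟨hab, he⟩ := deleteEdges_adj.1 hab
        obtain ⟨rfl, rfl⟩ := hC b a hab.symm hb ih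
        exact he rfl
    exact D.par_notMem v hv (hall _ ((reachable_iff_reflTransGen _ _).1 h))
  · rintro ⟨x, y, hx, hy, hxy, hl⟩
    have hle : T.deleteEdges {s(v, par v)} ≤
        (graphAt T G M f i).deleteEdges {s(v, par v)} := by
      intro a b hab
      obtain ⟨hab, he⟩ := deleteEdges_adj.1 hab
      exact deleteEdges_adj.2 ⟨(fromEdgeSet_adj _).2 ⟨Or.inl hab, hab.ne⟩, he⟩
    have hadj : ((graphAt T G M f i).deleteEdges {s(v, par v)}).Adj y x := by
      refine deleteEdges_adj.2 ⟨(fromEdgeSet_adj _).2 ⟨Or.inr (hl.symm.mem_levelLe hf),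
        hl.1.ne'⟩, fun he => hxy ?_⟩
      rw [← mem_edgeSet, Sym2.eq_swap, Set.mem_singleton_iff.1 he, Sym2.eq_swap]
      exact D.par_adj v hv
    exact (Reachable.mono hle hy).trans (hadj.reachable.trans
      ((reachable_par_of_notMem_subtree hT hx).mono hle).symm)

/-- A tree path through the parent edge of `v` has exactly one endpoint in the subtree of `v`. -/
lemma mem_subtree_iff_notMem_of_mem_edges (hT : T.IsTree) {u w v : V} {p : T.Walk u w}
    (hp : p.IsPath) (he : s(v, par v) ∈ p.edges) :
    u ∈ subtree T par v ↔ w ∉ subtree T par v := by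
  constructor
  · exact fun hu hw => notMem_edges_of_reachable hT.isAcyclic hp
      (Reachable.trans (Reachable.symm hu) hw) he
  · intro hw
    by_contra hu
    exact notMem_edges_of_reachable hT.isAcyclic hp
      ((reachable_par_of_notMem_subtree hT.connected hu).symm.trans
        (reachable_par_of_notMem_subtree hT.connected hw)) he

/-- Fundamental cycles covering the bridges that disappear at each level give a cover. -/
lemma SubtreeData.cover (hf : ¬ Matched M f) (hT : T.IsTree) {R : V → ℕ}
    (D : SubtreeData G M f T par R (subtree T par)) {k : ℕ} {Fc : ℕ → Set (Sym2 V)}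
    (hFc : ∀ i, 1 ≤ i → i ≤ k → Fc i ⊆ levelSet G M f i \ T.edgeSet)
    (hcover : ∀ i, 1 ≤ i → i ≤ k →
      ∀ e ∈ Bset T G M f (i - 1) \ Bset T G M f i,
        ∃ u w : V, s(u, w) ∈ Fc i ∧ e ∈ cycEdges T u w) :
    Cover G M f T (subtree T par) k
      (fun i => SimpleGraph.fromEdgeSet (T.edgeSet ∪ ⋃ j ∈ Finset.Icc 1 i, Fc j)) := by
  refine ⟨?_, ?_, ?_, ?_⟩
  · intro i x y h
    exact (fromEdgeSet_adj _).2 ⟨Or.inl h, h.ne⟩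
  · intro i j hij
    refine fromEdgeSet_mono (Set.union_subset_union_right _ ?_)
    exact Set.biUnion_subset_biUnion_left (Finset.Icc_subset_Icc_right hij)
  · intro i hik x y h
    obtain ⟨h | h, -⟩ := (fromEdgeSet_adj _).1 h
    · exact Or.inl h
    · right
      simp only [Set.mem_iUnion, Finset.mem_Icc] at h
      obtain ⟨j, ⟨hj1, hji⟩, hmem⟩ := h
      exact levelAtMost_of_mem_levelLe hf ⟨j, hj1, hji, (hFc j hj1 (hji.trans hik) hmem).1⟩
  · intro i hik hi v hv hc hnc
    obtain ⟨u, w, huw, he⟩ := hcover i hi hik s(v, par v)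
      ⟨(D.mem_Bset_iff hf hT.connected hv).2 hnc,
        fun hB => (D.mem_Bset_iff hf hT.connected hv).1 hB hc⟩
    obtain ⟨hlev, hnT⟩ := hFc i hi hik huw
    have hl : LevelAtMost G M f i u w := levelAtMost_of_mem_levelLe hf ⟨i, hi, le_rfl, hlev⟩
    have hadj : (SimpleGraph.fromEdgeSet (T.edgeSet ∪ ⋃ j ∈ Finset.Icc 1 i, Fc j)).Adj u w := by
      refine (fromEdgeSet_adj _).2 ⟨Or.inr ?_, hl.1.ne⟩
      simp only [Set.mem_iUnion, Finset.mem_Icc]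
      exact ⟨i, ⟨hi, le_rfl⟩, huw⟩
    rcases he with he | ⟨p, hp, he⟩
    · refine absurd ?_ hnT
      rw [← he, Sym2.eq_swap]
      exact D.par_adj v hv
    · have hiff := mem_subtree_iff_notMem_of_mem_edges hT hp he
      by_cases hu : u ∈ subtree T par v
      · exact ⟨w, u, hiff.1 hu, hu, hadj.symm, hl.symm⟩
      · exact ⟨u, w, hu, by_contra fun hw => hu (hiff.2 hw), hadj, hl⟩

end Subtree

/-- If, for each `1 ≤ i ≤ k`, `F^c_i ⊆ F_i ∖ E(T)` is a set of non-tree edges whose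
fundamental cycles cover `B_{i−1} ∖ B_i`, then `H_k = T + ∪_{1≤i≤k} F^c_i` preserves the
reachability of `G_k`. -/
theorem statement7 {V : Type*} [Fintype V] (G : SimpleGraph V) (M : Set (Sym2 V))
    (hM : IsMatching G M) (f : V) (hf : ¬ Matched M f)
    (hreach : ∀ x, ThetaReach G M 0 f x ∨ ThetaReach G M 1 f x)
    (T : SimpleGraph V) (par : V → V) (habt : AltBaseTree G M f T par)
    (k : ℕ) (Fc : ℕ → Set (Sym2 V))
    (hFc : ∀ i, 1 ≤ i → i ≤ k → Fc i ⊆ levelSet G M f i \ T.edgeSet)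
    (hcover : ∀ i, 1 ≤ i → i ≤ k →
      ∀ e ∈ Bset T G M f (i - 1) \ Bset T G M f i,
        ∃ u w : V, s(u, w) ∈ Fc i ∧ e ∈ cycEdges T u w) :
    ∀ (v : V) (θ : ℕ), θ ≤ 1 →
      ThetaReach (graphAt T G M f k) M θ f v →
      ThetaReach (SimpleGraph.fromEdgeSet (T.edgeSet ∪ ⋃ i ∈ Finset.Icc 1 k, Fc i))
        M θ f v := by
  classical
  have hex : ∀ v, ∃ n, ReachLen G M f n v := by
    intro v
    rcases hreach v with h | h <;>
      exact ((thetaReach_iff hf).1 h).imp fun _ h => h.2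
  have D := habt.subtreeData hf (fun v => Nat.find_spec (hex v))
    (fun v _ h => Nat.find_min' (hex v) h)
  intro v θ _ h
  obtain ⟨n, hn, S, hS⟩ := (thetaReach_iff hf).1 h
  obtain ⟨m, hm, hr⟩ := D.reach_preserved (D.cover hf habt.tree hFc hcover)
    (fun _ _ => graphAt_adj hf) hS
  exact (thetaReach_iff hf).2 ⟨m, hm.trans hn, hr⟩

end MM
end
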